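/- Let s ≥ 2 be an integer, R = k[x,y,z] the standard graded polynomial ring over a field k, and V_s^s the (2s+1)×(2s+1) alternating matrix defined below. Then the ideal I := (Pf_j(V_s^s) : j ≠ s+1) + R_+ · Pf_{s+1}(V_s^s) defines a ring R/I of Tor algebra class G(2s−1). -/

import Mathlib

open MvPolynomial Module

noncomputable section

/-- The standard graded polynomial ring `k[x_1, …, x_n]` (each variable of degree 1). -/
abbrev MvP (n : ℕ) (k : Type) [Field k] := MvPolynomial (Fin n) k

variable {n : ℕ} {k : Type} [Field k]

/-- The irrelevant ideal `R₊ = (x_1, …, x_n)`. -/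
def irrIdeal (n : ℕ) (k : Type) [Field k] : Ideal (MvP n k) :=
  Ideal.span (Set.range X)

/-- A homogeneous ideal (w.r.t. the standard grading). -/
def IsHomogIdeal (I : Ideal (MvP n k)) : Prop :=
  ∀ f ∈ I, ∀ j : ℕ, homogeneousComponent j f ∈ I

/-- `gradeGE I m` : the ideal `I` contains an `R`-regular sequence of length `m`. -/
def gradeGE {R : Type} [CommRing R] (I : Ideal R) (m : ℕ) : Prop :=
  ∃ rs : List R, rs.length = m ∧ (∀ r ∈ rs, r ∈ I) ∧ RingTheory.Sequence.IsRegular R rs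

/-- `hasGrade I m` : the grade (length of a maximal `R`-regular sequence contained in `I`)
is exactly `m`. -/
def hasGrade {R : Type} [CommRing R] (I : Ideal R) (m : ℕ) : Prop :=
  gradeGE I m ∧ ¬ gradeGE I (m + 1)

/-- `mu I` : the minimal number of generators of `I`. -/
def mu {R : Type} [CommRing R] (I : Ideal R) : ℕ :=
  sInf {m | ∃ f : Fin m → R, Ideal.span (Set.range f) = I}

/-- The degree-`j` graded piece of `R/I` (the image of the degree-`j` forms). -/
def aDeg (I : Ideal (MvP n k)) (j : ℕ) : Submodule k (MvP n k ⧸ I) :=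
  Submodule.map (Ideal.Quotient.mkₐ k I).toLinearMap (homogeneousSubmodule (Fin n) k j)

/-- The socle `(0 :_{R/I} R₊)` of `R/I`, as a `k`-subspace of `R/I`. -/
def socle (I : Ideal (MvP n k)) : Submodule k (MvP n k ⧸ I) where
  carrier := {a | ∀ i : Fin n, Ideal.Quotient.mk I (X i) * a = 0}
  add_mem' := by intro a b ha hb i; rw [mul_add, ha i, hb i, add_zero]
  zero_mem' := by intro i; rw [mul_zero]
  smul_mem' := by intro c a ha i; rw [mul_smul_comm, ha i, smul_zero]

/-- `Soc(R/I) = k(-c)` : the socle is one–dimensional, concentrated in degree `c`.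
(For an Artinian quotient this says exactly that `R/I` is Gorenstein with socle degree `c`.) -/
def SocleOne (I : Ideal (MvP n k)) (c : ℕ) : Prop :=
  finrank k (socle I) = 1 ∧ finrank k ↥(socle I ⊓ aDeg I c) = 1

/-- `Soc(R/I) = k(-a) ⊕ k(-b)` : the socle is two–dimensional, with one basis vector in
degree `a` and one in degree `b`. -/
def SocleTwo (I : Ideal (MvP n k)) (a b : ℕ) : Prop :=
  finrank k (socle I) = 2 ∧
    finrank k ↥(socle I ⊓ aDeg I a) = 1 ∧ finrank k ↥(socle I ⊓ aDeg I b) = 1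

/-- A standard graded Artinian algebra `A = R/I` with embedding dimension
`e = dim_k A₁`, top socle degree `s` (the largest `s` with `A_s = 𝔪^s ≠ 0`), and socle
polynomial `∑ cᵢ zⁱ` (where `cᵢ = dim_k (Soc A)ᵢ`) is compressed if
`dim_k Aᵢ = min { C(e-1+i, i), ∑_ℓ c_ℓ · C(e-1+ℓ-i, ℓ-i) }` for all `0 ≤ i ≤ s`. -/
def IsCompressed (I : Ideal (MvP n k)) : Prop :=
  ∃ s : ℕ, aDeg I s ≠ ⊥ ∧ (∀ j, s < j → aDeg I j = ⊥) ∧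
    ∀ i ≤ s,
      finrank k ↥(aDeg I i) =
        min (Nat.choose (finrank k ↥(aDeg I 1) - 1 + i) i)
          (∑ l ∈ Finset.Icc i s,
            finrank k ↥(socle I ⊓ aDeg I l) *
              Nat.choose (finrank k ↥(aDeg I 1) - 1 + (l - i)) (l - i))

/-- The image of `X i` in `R/I`. -/
def xq (I : Ideal (MvP n k)) (i : Fin n) : MvP n k ⧸ I :=
  Ideal.Quotient.mk I (X i)

/-- First Koszul differential `Λ¹(k³) ⊗ R/I → R/I` on `x, y, z`. -/
def kosd1 (I : Ideal (MvP 3 k)) : (Fin 3 → MvP 3 k ⧸ I) →ₗ[k] MvP 3 k ⧸ I where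
  toFun u := ∑ i, xq I i * u i
  map_add' u v := by simp [mul_add, Finset.sum_add_distrib]
  map_smul' c u := by simp [Finset.smul_sum, mul_smul_comm]

set_option synthInstance.maxHeartbeats 1000000 in
/-- Second Koszul differential `Λ²(k³) ⊗ R/I → Λ¹(k³) ⊗ R/I`; in the bases
`e₂∧e₃, e₃∧e₁, e₁∧e₂` resp. `e₁, e₂, e₃` it is the cross product with `(x,y,z)`. -/
def kosd2 (I : Ideal (MvP 3 k)) : (Fin 3 → MvP 3 k ⧸ I) →ₗ[k] (Fin 3 → MvP 3 k ⧸ I) :=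
  (crossProduct (fun i => xq I i)).restrictScalars k

/-- Third Koszul differential `Λ³(k³) ⊗ R/I → Λ²(k³) ⊗ R/I`. -/
def kosd3 (I : Ideal (MvP 3 k)) : (MvP 3 k ⧸ I) →ₗ[k] (Fin 3 → MvP 3 k ⧸ I) where
  toFun c := fun i => xq I i * c
  map_add' a b := by funext i; simp [mul_add]
  map_smul' c a := by funext i; simp [mul_smul_comm]

/-- The wedge multiplication `Λ¹ × Λ² → Λ³` in the above bases: the dot product. -/
def dotP (I : Ideal (MvP 3 k)) (u v : Fin 3 → MvP 3 k ⧸ I) : MvP 3 k ⧸ I :=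
  ∑ i, u i * v i

/-- `R/I` has Tor algebra class `G(r)`.  The Tor algebra `T_• = Tor_•^R(R/I,k)` is
computed as the homology of the Koszul complex `Λ^•(k³) ⊗ R/I` with its wedge
multiplication (`T₁×T₁ → T₂` is the cross product and `T₁×T₂ → T₃` the dot product in the
bases above; `T₃` has no nonzero boundaries, so equality of classes in `T₃` is literal
equality, and products of cycles with boundaries are boundaries, so the conditions below
are well-posed conditions on homology classes).  With `m = μ(I)` and
`t = dim_k Soc(R/I)` (the type), there must exist bases `e` of `T₁` (classes of cycles
`z`), `f` of `T₂` (classes of cycles `w`) and `g` of `T₃` (elements `v` of `ker d₃`) such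
that the only nonzero products among basis elements are `e_i f_i = f_i e_i = g₁` for
`1 ≤ i ≤ r`.  (Products `T₁·T₃`, `T₂·T₂`, … land in `Λ^{≥4} = 0` automatically.) -/
def TorClassG (I : Ideal (MvP 3 k)) (r : ℕ) : Prop :=
  ∃ (m t : ℕ) (ht : 0 < t),
    m = mu I ∧ t = finrank k (socle I) ∧
    ∃ (z : Fin m → (Fin 3 → MvP 3 k ⧸ I)) (w : Fin (m + t - 1) → (Fin 3 → MvP 3 k ⧸ I))
      (v : Fin t → (MvP 3 k ⧸ I)),
      (∀ i, z i ∈ LinearMap.ker (kosd1 I)) ∧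
      (∀ i, w i ∈ LinearMap.ker (kosd2 I)) ∧
      (∀ i, v i ∈ LinearMap.ker (kosd3 I)) ∧
      -- the classes of the `z i` form a basis of `T₁ = ker d₁ / im d₂`:
      LinearMap.ker (kosd1 I) ≤ Submodule.span k (Set.range z) ⊔ LinearMap.range (kosd2 I) ∧
      (∀ c : Fin m → k, (∑ i, c i • z i) ∈ LinearMap.range (kosd2 I) → c = 0) ∧
      -- the classes of the `w i` form a basis of `T₂ = ker d₂ / im d₃`:
      LinearMap.ker (kosd2 I) ≤ Submodule.span k (Set.range w) ⊔ LinearMap.range (kosd3 I) ∧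
      (∀ c : Fin (m + t - 1) → k, (∑ i, c i • w i) ∈ LinearMap.range (kosd3 I) → c = 0) ∧
      -- the `v i` form a basis of `T₃ = ker d₃`:
      LinearIndependent k v ∧ LinearMap.ker (kosd3 I) ≤ Submodule.span k (Set.range v) ∧
      -- `T₁ · T₁ = 0`:
      (∀ i j, crossProduct (z i) (z j) ∈ LinearMap.range (kosd2 I)) ∧
      -- the only nonzero products among the basis elements are `e_i f_i = g₁`, `1 ≤ i ≤ r`:
      (∀ (i : Fin m) (j : Fin (m + t - 1)),
        dotP I (z i) (w j) = if ((i : ℕ) = (j : ℕ) ∧ (i : ℕ) < r) then v ⟨0, ht⟩ else 0)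

/-- The Pfaffian of a `2m × 2m` matrix (intended for alternating matrices), defined by
recursive expansion along the first row:
`pf(A) = ∑_j (-1)^j ⬝ A 0 (j+1) ⬝ pf(A with rows/columns 0 and j+1 removed)`. -/
def pfAux {R : Type} [CommRing R] :
    (m : ℕ) → Matrix (Fin (2 * m)) (Fin (2 * m)) R → R
  | 0, _ => 1
  | (m + 1), A =>
      ∑ j : Fin (2 * m + 1),
        (-1 : R) ^ (j : ℕ) * A 0 j.succ *
          pfAux m (A.submatrix (fun i : Fin (2 * m) => Fin.succ (j.succAbove i))
            (fun i : Fin (2 * m) => Fin.succ (j.succAbove i)))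

/-- `subPf M i` : the submaximal Pfaffian `Pf_i(M)` of a `(2m+1) × (2m+1)` (alternating)
matrix `M`: the Pfaffian of the matrix obtained by deleting the `i`-th row and column. -/
def subPf {R : Type} [CommRing R] {m : ℕ}
    (M : Matrix (Fin (2 * m + 1)) (Fin (2 * m + 1)) R) (i : Fin (2 * m + 1)) : R :=
  pfAux m (M.submatrix i.succAbove i.succAbove)

/-- The ideal `Pf(M)` of submaximal Pfaffians of `M`. -/
def pfIdeal {R : Type} [CommRing R] {m : ℕ}
    (M : Matrix (Fin (2 * m + 1)) (Fin (2 * m + 1)) R) : Ideal R :=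
  Ideal.span (Set.range (subPf M))

/-- A matrix is alternating: skew-symmetric with zero diagonal. -/
def IsAlternating {R : Type} [CommRing R] {m : ℕ} (M : Matrix (Fin m) (Fin m) R) : Prop :=
  M.transpose = -M ∧ ∀ i, M i i = 0

/-- The "trimmed" ideal `(Pf_j(M) : j ≠ i₀) + J · (Pf_{i₀}(M))`. -/
def trimPf {R : Type} [CommRing R] {m : ℕ}
    (M : Matrix (Fin (2 * m + 1)) (Fin (2 * m + 1)) R)
    (i₀ : Fin (2 * m + 1)) (J : Ideal R) : Ideal R :=
  Ideal.span {p | ∃ j ≠ i₀, p = subPf M j} ⊔ J * Ideal.span {subPf M i₀}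

/-- The `m×m` matrix `U_m^j` over `k[x,y,z]` (Definition of Section 7 of the paper,
with `x = X 0`, `y = X 1`, `z = X 2`): in 1-based indexing,
`(U_m^j)_{i,m−i} = x²`, `(U_m^j)_{i,m−i+1} = z²`, `(U_m^j)_{i,m−i+2} = y²` for
`i ≤ m−j`, the same entries with `x, z, y` for `i > m−j`, and all other entries `0`. -/
def Umat (k : Type) [Field k] (m j : ℕ) : Matrix (Fin m) (Fin m) (MvP 3 k) :=
  Matrix.of fun a b =>
    if (a : ℕ) + (b : ℕ) + 2 = m then (if (a : ℕ) + 1 + j ≤ m then X 0 ^ 2 else X 0)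
    else if (a : ℕ) + (b : ℕ) + 1 = m then (if (a : ℕ) + 1 + j ≤ m then X 2 ^ 2 else X 2)
    else if (a : ℕ) + (b : ℕ) = m then (if (a : ℕ) + 1 + j ≤ m then X 1 ^ 2 else X 1)
    else 0

/-- The `(2m+1)×(2m+1)` alternating matrix `V_m^m` with block form
`[[O, O_{x²}, (U_m^m)ᵀ], [−(O_{x²})ᵀ, 0, ʸO], [−U_m^m, −(ʸO)ᵀ, O]]`,
where `O_{x²}` is the `m×1` column with `x²` in the bottom entry and zeros elsewhere,
and `ʸO` is the `1×m` row with `y` in the first entry and zeros elsewhere. -/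
def Vmat (k : Type) [Field k] (m : ℕ) :
    Matrix (Fin (2 * m + 1)) (Fin (2 * m + 1)) (MvP 3 k) :=
  Matrix.of fun a b =>
    if ha : (a : ℕ) < m then
      (if hb : (b : ℕ) < m then 0
       else if hbm : (b : ℕ) = m then (if (a : ℕ) + 1 = m then X 0 ^ 2 else 0)
       else Umat k m m ⟨(b : ℕ) - m - 1, by have := b.isLt; omega⟩ ⟨(a : ℕ), ha⟩)
    else if haeq : (a : ℕ) = m then
      (if hb : (b : ℕ) < m then (if (b : ℕ) + 1 = m then -(X 0 ^ 2) else 0)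
       else if hbm : (b : ℕ) = m then 0
       else (if (b : ℕ) = m + 1 then X 1 else 0))
    else
      (if hb : (b : ℕ) < m then
        -(Umat k m m ⟨(a : ℕ) - m - 1, by have := a.isLt; omega⟩ ⟨(b : ℕ), hb⟩)
       else if hbm : (b : ℕ) = m then (if (a : ℕ) = m + 1 then -(X 1) else 0)
       else 0)

section Pfaffian

variable {R : Type} [CommRing R]

/-- A Pfaffian vanishes as soon as the lower right zero block exceeds half the size. -/
lemma pfAux_eq_zero (m : ℕ) (A : Matrix (Fin (2 * (m + 1))) (Fin (2 * (m + 1))) R)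
    (h : ∀ i j : Fin (2 * (m + 1)), m ≤ (i : ℕ) → m ≤ (j : ℕ) → A i j = 0) : pfAux (m + 1) A = 0 := by
  induction m with
  | zero =>
    rw [pfAux]
    exact Finset.sum_eq_zero fun j _ => by rw [h 0 j.succ (by simp) (by simp)]; ring
  | succ m ih =>
    rw [pfAux]
    refine Finset.sum_eq_zero fun j _ => ?_
    rw [ih, mul_zero]
    intro a b ha hb
    refine h _ _ ?_ ?_
    · have : (a : ℕ) ≤ (j.succAbove a : ℕ) := by
        rw [Fin.succAbove]; split_ifs <;> simp
      simp only [Fin.val_succ]; omega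
    · have : (b : ℕ) ≤ (j.succAbove b : ℕ) := by
        rw [Fin.succAbove]; split_ifs <;> simp
      simp only [Fin.val_succ]; omega

lemma sum_fin_upper {M : Type} [AddCommMonoid M] (m : ℕ) (f : Fin (2 * m + 1) → M)
    (hf : ∀ j : Fin (2 * m + 1), (j : ℕ) < m → f j = 0) :
    ∑ j, f j = ∑ b : Fin (m + 1), f ⟨m + b, by omega⟩ := by
  symm
  refine Finset.sum_of_injOn (fun b => ⟨m + b, by omega⟩) ?_ ?_ ?_ ?_
  · intro a _ b _ hab
    simpa [Fin.ext_iff] using hab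
  · intro a _; simp
  · intro j _ hj
    refine hf j ?_
    by_contra hc
    refine hj ⟨⟨(j : ℕ) - m, by omega⟩, by simp, ?_⟩
    ext; simp; omega
  · intro a _; rfl

/-- The upper right block of a matrix of even size. -/
def upperRight {S : Type} (m : ℕ) (A : Matrix (Fin (2 * m)) (Fin (2 * m)) S) :
    Matrix (Fin m) (Fin m) S :=
  Matrix.of fun i j => A ⟨i, by omega⟩ ⟨m + j, by omega⟩

lemma upperRight_minor {S : Type} (m : ℕ) (A : Matrix (Fin (2 * (m + 1))) (Fin (2 * (m + 1))) S)
    (b : Fin (m + 1)) :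
    upperRight m (A.submatrix
      (fun i : Fin (2 * m) => Fin.succ ((⟨m + b, by omega⟩ : Fin (2 * m + 1)).succAbove i))
      (fun i : Fin (2 * m) => Fin.succ ((⟨m + b, by omega⟩ : Fin (2 * m + 1)).succAbove i))) =
    (upperRight (m + 1) A).submatrix Fin.succ b.succAbove := by
  ext i j
  simp only [upperRight, Matrix.of_apply, Matrix.submatrix_apply]
  congr 1
  · ext
    simp only [Fin.succAbove, Fin.lt_def, Fin.val_castSucc, Fin.val_succ]
    rw [if_pos (by omega)]; simp
  · ext
    simp only [Fin.succAbove, Fin.lt_def, Fin.val_castSucc, Fin.val_succ]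
    split_ifs <;> simp at * <;> omega

lemma pfAux_succ_of_upper (m : ℕ) (A : Matrix (Fin (2 * (m + 1))) (Fin (2 * (m + 1))) R)
    (e : ℕ)
    (h0 : ∀ j : Fin (2 * m + 1), (j : ℕ) < m → A 0 j.succ *
      pfAux m (A.submatrix (fun i : Fin (2 * m) => Fin.succ (j.succAbove i))
            (fun i : Fin (2 * m) => Fin.succ (j.succAbove i))) = 0)
    (h1 : ∀ j : Fin (2 * m + 1), m ≤ (j : ℕ) →
      pfAux m (A.submatrix (fun i : Fin (2 * m) => Fin.succ (j.succAbove i))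
            (fun i : Fin (2 * m) => Fin.succ (j.succAbove i))) =
      (-1) ^ e * (upperRight m (A.submatrix (fun i : Fin (2 * m) => Fin.succ (j.succAbove i))
            (fun i : Fin (2 * m) => Fin.succ (j.succAbove i)))).det) :
    pfAux (m + 1) A = (-1) ^ (e + m) * (upperRight (m + 1) A).det := by
  rw [pfAux, sum_fin_upper m _ (fun j hj => by rw [mul_assoc, h0 j hj, mul_zero]),
    Matrix.det_succ_row_zero, Finset.mul_sum]
  refine Finset.sum_congr rfl fun b _ => ?_
  rw [h1 _ (by simp), upperRight_minor]
  have : A 0 (Fin.succ (⟨m + b, by omega⟩ : Fin (2 * m + 1))) = upperRight (m + 1) A 0 b := by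
    simp only [upperRight, Matrix.of_apply]
    congr 1
    ext; simp; omega
  rw [this]
  simp only [pow_add]
  ring

lemma pfAux_of_upper_zero (m : ℕ) (A : Matrix (Fin (2 * m)) (Fin (2 * m)) R)
    (h : ∀ i j : Fin (2 * m), (i : ℕ) < m → (j : ℕ) < m → A i j = 0) :
    pfAux m A = (-1) ^ (∑ i ∈ Finset.range m, i) * (upperRight m A).det := by
  induction m with
  | zero => simp [pfAux]
  | succ m ih =>
    rw [Finset.sum_range_succ]
    refine pfAux_succ_of_upper m A _ (fun j hj => ?_) (fun j hj => ih _ ?_)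
    · rw [h 0 j.succ (by simp) (by simpa using hj), zero_mul]
    · intro a b ha hb
      refine h _ _ ?_ ?_
      · simp only [Fin.succAbove, Fin.lt_def, Fin.val_castSucc, Fin.val_succ]
        rw [if_pos (by omega)]; simpa using ha
      · simp only [Fin.succAbove, Fin.lt_def, Fin.val_castSucc, Fin.val_succ]
        rw [if_pos (by omega)]; simpa using hb

lemma pfAux_of_lower_zero (m : ℕ) (A : Matrix (Fin (2 * m)) (Fin (2 * m)) R)
    (h : ∀ i j : Fin (2 * m), m ≤ (i : ℕ) → m ≤ (j : ℕ) → A i j = 0) :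
    pfAux m A = (-1) ^ (∑ i ∈ Finset.range m, i) * (upperRight m A).det := by
  induction m with
  | zero => simp [pfAux]
  | succ m ih =>
    rw [Finset.sum_range_succ]
    refine pfAux_succ_of_upper m A _ (fun j hj => ?_) (fun j hj => ih _ ?_)
    · obtain ⟨m, rfl⟩ : ∃ l, m = l + 1 := ⟨m - 1, by omega⟩
      rw [pfAux_eq_zero, mul_zero]
      intro a b ha hb
      refine h _ _ ?_ ?_
      · simp only [Fin.succAbove, Fin.lt_def, Fin.val_castSucc]
        rw [if_neg (by omega)]; simpa using ha
      · simp only [Fin.succAbove, Fin.lt_def, Fin.val_castSucc]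
        rw [if_neg (by omega)]; simpa using hb
    · intro a b ha hb
      refine h _ _ ?_ ?_
      · have : (a : ℕ) ≤ (j.succAbove a : ℕ) := by
          rw [Fin.succAbove]; split_ifs <;> simp
        simp only [Fin.val_succ]; omega
      · have : (b : ℕ) ≤ (j.succAbove b : ℕ) := by
          rw [Fin.succAbove]; split_ifs <;> simp
        simp only [Fin.val_succ]; omega

end Pfaffian

section Continuant

variable {R : Type} [CommRing R]

/-- The continuant: `cont x y z (c + 1)` is the determinant of the `c × c` tridiagonal Toeplitz
matrix with `z` on the diagonal, `x` above and `y` below it; moreover `cont x y z 0 = 0`. -/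
def cont (x y z : R) : ℕ → R
  | 0 => 0
  | 1 => 1
  | (c + 2) => z * cont x y z (c + 1) - x * y * cont x y z c

lemma cont_swap (x y z : R) (c : ℕ) : cont y x z c = cont x y z c := by
  induction c using Nat.twoStepInduction with
  | zero => rfl
  | one => rfl
  | more c h0 h1 => rw [cont, cont, h0, h1, mul_comm y x]

/-- The entries of the infinite tridiagonal Toeplitz matrix. -/
def tri (x y z : R) (i j : ℕ) : R :=
  if j = i + 1 then x else if j = i then z else if i = j + 1 then y else 0

lemma tri_swap (x y z : R) (i j : ℕ) : tri x y z i j = tri y x z j i := by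
  unfold tri; split_ifs <;> first | rfl | omega

lemma tri_succ (x y z : R) (i j : ℕ) : tri x y z (i + 1) (j + 1) = tri x y z i j := by
  simp [tri]

lemma det_tri (x y z : R) (c : ℕ) :
    (Matrix.of fun a b : Fin c => tri x y z a b).det = cont x y z (c + 1) := by
  induction c using Nat.twoStepInduction with
  | zero => simp [cont]
  | one => simp [cont, tri]
  | more c h0 h1 =>
    rw [cont, ← h0, ← h1, Matrix.det_succ_row_zero, Fin.sum_univ_succ, Fin.sum_univ_succ,
      Finset.sum_eq_zero, add_zero]
    · have e0 : ((Matrix.of fun a b : Fin (c + 2) => tri x y z a b).submatrix Fin.succ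
          (Fin.succAbove 0)) = Matrix.of fun a b : Fin (c + 1) => tri x y z a b := by
        ext a b; simp [tri_succ]
      have e1 : ((Matrix.of fun a b : Fin (c + 2) => tri x y z a b).submatrix Fin.succ
          (Fin.succAbove (Fin.succ 0))).det =
          y * (Matrix.of fun a b : Fin c => tri x y z a b).det := by
        rw [Matrix.det_succ_column_zero, Fin.sum_univ_succ, Finset.sum_eq_zero, add_zero]
        · have : ((Matrix.of fun a b : Fin (c + 2) => tri x y z a b).submatrix Fin.succ
            (Fin.succAbove (Fin.succ 0))).submatrix (Fin.succAbove 0) Fin.succ =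
            Matrix.of fun a b : Fin c => tri x y z a b := by
            ext a b
            simp [Fin.succAbove, Fin.lt_def, tri_succ]
          rw [this]
          simp [Fin.succAbove, tri]
        · intro a _
          simp [Fin.succAbove, tri]
      rw [e0, e1]
      simp [tri]
      ring
    · intro a _
      simp [tri]

/-- Deleting row `j` of the tridiagonal Toeplitz matrix gives a block triangular matrix. -/
lemma det_tri_skip (x y z : R) (j d : ℕ) :
    (Matrix.of fun a b : Fin (j + d) =>
      tri x y z (if (a : ℕ) < j then a else a + 1) b).det = cont x y z (j + 1) * y ^ d := by
  induction d with
  | zero =>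
    rw [pow_zero, mul_one, ← det_tri]
    congr 1
    ext a b
    simp
  | succ d ih =>
    change (Matrix.of fun a b : Fin (j + d + 1) =>
      tri x y z (if (a : ℕ) < j then a else a + 1) b).det = _
    rw [Matrix.det_succ_row _ (Fin.last _), Fin.sum_univ_castSucc, Finset.sum_eq_zero, zero_add]
    · have : ((Matrix.of fun a b : Fin (j + d + 1) =>
          tri x y z (if (a : ℕ) < j then a else a + 1) b).submatrix
          (Fin.last (j + d)).succAbove (Fin.last (j + d)).succAbove) =
          Matrix.of fun a b : Fin (j + d) =>
            tri x y z (if (a : ℕ) < j then a else a + 1) b := by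
        ext a b
        simp
      rw [this, ih]
      simp [tri, ← two_mul, pow_mul, add_assoc, pow_succ]
      ring
    · intro a _
      have := a.isLt
      simp only [Fin.val_last, Fin.val_castSucc, Matrix.of_apply, tri]
      rw [if_neg (by omega : ¬ (j + d < j)), if_neg (by omega), if_neg (by omega),
        if_neg (by omega)]
      ring

lemma det_rev {m : ℕ} (A : Matrix (Fin m) (Fin m) R) :
    A.det = (A.submatrix id Fin.rev).det ∨ A.det = -(A.submatrix id Fin.rev).det := by
  have h := Matrix.det_permute' (Fin.revPerm (n := m)) A
  have h2 : (A.submatrix id (Fin.revPerm (n := m))) = A.submatrix id Fin.rev := rfl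
  rw [h2] at h
  rcases Int.units_eq_one_or (Equiv.Perm.sign (Fin.revPerm (n := m))) with hs | hs <;>
    rw [hs] at h <;> simp at h
  · exact Or.inl h.symm
  · right; rw [h, neg_neg]

lemma neg_one_pow_mul_eq_or_neg (e : ℕ) {a b c : R} (h : a = (-1) ^ e * b)
    (hb : b = c ∨ b = -c) : a = c ∨ a = -c := by
  subst h
  rcases neg_one_pow_eq_or R e with h | h <;> rcases hb with hb | hb <;> simp [h, hb]

end Continuant

section Vmat

/-- The continuant of the three variables of the polynomial ring. -/
abbrev E3 (k : Type) [Field k] (c : ℕ) : MvP 3 k := cont (X 0) (X 1) (X 2) c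

lemma Vmat_apply_right (s : ℕ) (a b : Fin (2 * s + 1)) {i c : ℕ} (hi : (a : ℕ) = i)
    (hc : (b : ℕ) + c = 2 * s) (his : i ≤ s) (hcs : c < s) :
    Vmat k s a b = tri (X 0) (X 1) (X 2) i c := by
  simp only [Vmat, Umat, Matrix.of_apply, tri]
  split_ifs <;> first | rfl | omega

lemma Vmat_apply_mid (s : ℕ) (a b : Fin (2 * s + 1)) {i c : ℕ} (hi : (a : ℕ) = i) (his : i < s)
    (hb : (b : ℕ) = s) (hc : c = s) :
    Vmat k s a b = X 0 * tri (X 0) (X 1) (X 2) i c := by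
  simp only [Vmat, Matrix.of_apply, tri]
  split_ifs <;> first | omega | ring1

lemma val_succAbove_mk {m j : ℕ} (hj : j < m + 1) (a : Fin m) :
    ((⟨j, hj⟩ : Fin (m + 1)).succAbove a : ℕ) = if (a : ℕ) < j then (a : ℕ) else a + 1 := by
  simp only [Fin.succAbove, Fin.lt_def, Fin.val_castSucc]
  split_ifs <;> rfl

lemma subPf_Vmat_le (j d : ℕ) :
    subPf (Vmat k (j + d)) ⟨j, by omega⟩ = X 1 ^ d * E3 k (j + 1) ∨
    subPf (Vmat k (j + d)) ⟨j, by omega⟩ = -(X 1 ^ d * E3 k (j + 1)) := by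
  refine neg_one_pow_mul_eq_or_neg _ (pfAux_of_lower_zero (j + d) _ ?_) ?_
  · intro a b ha hb
    have ha' := val_succAbove_mk (j := j) (by omega) a
    have hb' := val_succAbove_mk (j := j) (by omega) b
    rw [if_neg (by omega)] at ha' hb'
    simp only [Matrix.submatrix_apply, Vmat, Matrix.of_apply]
    rw [dif_neg (by omega), dif_neg (by omega), dif_neg (by omega), dif_neg (by omega)]
  · have key : (upperRight (j + d) ((Vmat k (j + d)).submatrix
        (⟨j, by omega⟩ : Fin (2 * (j + d) + 1)).succAbove
        (⟨j, by omega⟩ : Fin (2 * (j + d) + 1)).succAbove)).submatrix id Fin.rev =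
        Matrix.of fun a b : Fin (j + d) =>
          tri (X 0) (X 1) (X 2) (if (a : ℕ) < j then (a : ℕ) else a + 1) b := by
      ext1 a b
      have ha := a.isLt
      have hb := b.isLt
      have hr := Fin.val_rev b
      simp only [Matrix.submatrix_apply, id, upperRight, Matrix.of_apply]
      refine Vmat_apply_right _ _ _ (val_succAbove_mk _ _) ?_ ?_ hb
      · rw [val_succAbove_mk, if_neg (by simp; omega)]
        simp only []
        omega
      · split_ifs <;> omega
    have h := det_rev (upperRight (j + d) ((Vmat k (j + d)).submatrix
        (⟨j, by omega⟩ : Fin (2 * (j + d) + 1)).succAbove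
        (⟨j, by omega⟩ : Fin (2 * (j + d) + 1)).succAbove))
    rw [key, det_tri_skip, mul_comm _ (X 1 ^ d)] at h
    exact h

lemma subPf_Vmat_gt (c d : ℕ) (hd : 0 < d) :
    subPf (Vmat k (c + d)) ⟨c + 2 * d, by omega⟩ = X 0 ^ (d + 1) * E3 k (c + 1) ∨
    subPf (Vmat k (c + d)) ⟨c + 2 * d, by omega⟩ = -(X 0 ^ (d + 1) * E3 k (c + 1)) := by
  refine neg_one_pow_mul_eq_or_neg _ (pfAux_of_upper_zero (c + d) _ ?_) ?_
  · intro a b ha hb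
    have ha' := val_succAbove_mk (j := c + 2 * d) (by omega) a
    have hb' := val_succAbove_mk (j := c + 2 * d) (by omega) b
    rw [if_pos (by omega)] at ha' hb'
    simp only [Matrix.submatrix_apply, Vmat, Matrix.of_apply]
    rw [dif_pos (by omega), dif_pos (by omega)]
  · have hp : (∏ b : Fin (c + d), if (b : ℕ) + 1 = c + d then (X 0 : MvP 3 k) else 1) = X 0 := by
      rw [Finset.prod_eq_single (⟨c + d - 1, by omega⟩ : Fin (c + d))]
      · rw [if_pos (by simp; omega)]
      · intro b _ hb
        rw [if_neg]
        intro h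
        exact hb (by ext; simp; omega)
      · simp
    have hm := Matrix.det_mul_row
      (fun b : Fin (c + d) => if (b : ℕ) + 1 = c + d then (X 0 : MvP 3 k) else 1)
      (Matrix.of fun a b : Fin (c + d) =>
        tri (X 1 : MvP 3 k) (X 0) (X 2) (if (a : ℕ) < c then a else a + 1) b).transpose
    rw [hp, Matrix.det_transpose, det_tri_skip, cont_swap,
      show (X 0 : MvP 3 k) * (cont (X 0) (X 1) (X 2) (c + 1) * X 0 ^ d) =
        X 0 ^ (d + 1) * E3 k (c + 1) by ring] at hm
    rw [← hm]
    have key : (upperRight (c + d) ((Vmat k (c + d)).submatrix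
        (⟨c + 2 * d, by omega⟩ : Fin (2 * (c + d) + 1)).succAbove
        (⟨c + 2 * d, by omega⟩ : Fin (2 * (c + d) + 1)).succAbove)).submatrix id Fin.rev =
        Matrix.of fun i j : Fin (c + d) => (if (j : ℕ) + 1 = c + d then (X 0 : MvP 3 k) else 1) *
          (Matrix.of fun a b : Fin (c + d) =>
            tri (X 1 : MvP 3 k) (X 0) (X 2) (if (a : ℕ) < c then a else a + 1) b).transpose i j := by
      ext1 a b
      have ha := a.isLt
      have hb := b.isLt
      have hr := Fin.val_rev b
      simp only [Matrix.submatrix_apply, id, upperRight, Matrix.of_apply, Matrix.transpose_apply]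
      rw [tri_swap (X 1)]
      by_cases hbs : (b : ℕ) + 1 = c + d
      · rw [if_pos hbs]
        refine Vmat_apply_mid _ _ _ (i := a) ?_ ha ?_ ?_
        · rw [val_succAbove_mk, if_pos (by simp; omega)]
        · rw [val_succAbove_mk]
          simp only []
          split_ifs <;> omega
        · rw [if_neg (by omega), hbs]
      · rw [if_neg hbs, one_mul]
        refine Vmat_apply_right _ _ _ (i := a) ?_ ?_ ha.le ?_
        · rw [val_succAbove_mk, if_pos (by simp; omega)]
        · rw [val_succAbove_mk]
          simp only []
          split_ifs <;> omega
        · split_ifs <;> omega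
    rw [← key]
    exact det_rev _

end Vmat

section Coordinates

/-- The elements `x ^ a * y ^ b * E c`; those with `c ≠ 0` form a `k`-basis of `k[x, y, z]`. -/
def bas (k : Type) [Field k] (a b c : ℕ) : MvP 3 k := X 0 ^ a * X 1 ^ b * E3 k c

lemma bas_zero (a b : ℕ) : bas k a b 0 = 0 := by simp [bas, cont]

lemma X0_mul_bas (a b c : ℕ) : X 0 * bas k a b c = bas k (a + 1) b c := by
  simp only [bas]; ring

lemma X1_mul_bas (a b c : ℕ) : X 1 * bas k a b c = bas k a (b + 1) c := by
  simp only [bas]; ring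

lemma X2_mul_bas (a b c : ℕ) :
    X 2 * bas k a b (c + 1) = bas k a b (c + 2) + bas k (a + 1) (b + 1) c := by
  simp only [bas, E3, cont]; ring

/-- Multiplication by `x` in coordinates. -/
def opX (k : Type) [Field k] : (ℕ × ℕ × ℕ → k) →ₗ[k] (ℕ × ℕ × ℕ → k) where
  toFun F p := if p.1 = 0 then 0 else F (p.1 - 1, p.2.1, p.2.2)
  map_add' F G := by ext p; simp only [Pi.add_apply]; split_ifs <;> simp
  map_smul' c F := by ext p; simp only [Pi.smul_apply]; split_ifs <;> simp

/-- Multiplication by `y` in coordinates. -/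
def opY (k : Type) [Field k] : (ℕ × ℕ × ℕ → k) →ₗ[k] (ℕ × ℕ × ℕ → k) where
  toFun F p := if p.2.1 = 0 then 0 else F (p.1, p.2.1 - 1, p.2.2)
  map_add' F G := by ext p; simp only [Pi.add_apply]; split_ifs <;> simp
  map_smul' c F := by ext p; simp only [Pi.smul_apply]; split_ifs <;> simp

/-- Multiplication by `z` in coordinates. -/
def opZ (k : Type) [Field k] : (ℕ × ℕ × ℕ → k) →ₗ[k] (ℕ × ℕ × ℕ → k) where
  toFun F p := (if p.2.2 = 0 then 0 else F (p.1, p.2.1, p.2.2 - 1)) +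
    (if p.1 = 0 ∨ p.2.1 = 0 then 0 else F (p.1 - 1, p.2.1 - 1, p.2.2 + 1))
  map_add' F G := by
    ext p; simp only [Pi.add_apply]; split_ifs <;> ring
  map_smul' c F := by
    ext p; simp only [Pi.smul_apply]; split_ifs <;> simp [mul_add]

lemma opX_opZ (F : ℕ × ℕ × ℕ → k) : opZ k (opX k F) = opX k (opZ k F) := by
  ext ⟨a, b, c⟩
  rcases a with _ | _ | a <;> simp [opX, opZ]

lemma opY_opZ (F : ℕ × ℕ × ℕ → k) : opZ k (opY k F) = opY k (opZ k F) := by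
  ext ⟨a, b, c⟩
  rcases b with _ | _ | b <;> simp [opY, opZ]

lemma opX_single (a b c : ℕ) :
    opX k (Pi.single (a, b, c) 1) = Pi.single (a + 1, b, c) 1 := by
  ext ⟨p, q, r⟩
  simp only [opX, LinearMap.coe_mk, AddHom.coe_mk, Pi.single_apply, Prod.mk.injEq]
  split_ifs <;> first | rfl | omega

lemma opY_single (a b c : ℕ) :
    opY k (Pi.single (a, b, c) 1) = Pi.single (a, b + 1, c) 1 := by
  ext ⟨p, q, r⟩
  simp only [opY, LinearMap.coe_mk, AddHom.coe_mk, Pi.single_apply, Prod.mk.injEq]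
  split_ifs <;> first | rfl | omega

lemma opZ_single_zero (a b : ℕ) :
    opZ k (Pi.single (a, b, 0) 1) = Pi.single (a, b, 1) 1 := by
  ext ⟨p, q, r⟩
  simp only [opZ, LinearMap.coe_mk, AddHom.coe_mk, Pi.single_apply, Prod.mk.injEq]
  split_ifs <;> first | omega | tauto | simp

lemma opZ_single_succ (a b c : ℕ) :
    opZ k (Pi.single (a, b, c + 1) 1) =
      Pi.single (a, b, c + 2) 1 + Pi.single (a + 1, b + 1, c) 1 := by
  ext ⟨p, q, r⟩
  simp only [opZ, LinearMap.coe_mk, AddHom.coe_mk, Pi.add_apply, Pi.single_apply, Prod.mk.injEq]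
  split_ifs <;> first | omega | simp

/-- The coordinates of a polynomial in the basis `bas k a b (c + 1)`. -/
def coords (k : Type) [Field k] : MvP 3 k →ₗ[k] (ℕ × ℕ × ℕ → k) :=
  (basisMonomials (Fin 3) k).constr k
    fun d => (opZ k)^[d 2] (Pi.single (d 0, d 1, 0) 1)

lemma coords_monomial (d : Fin 3 →₀ ℕ) :
    coords k (monomial d 1) = (opZ k)^[d 2] (Pi.single (d 0, d 1, 0) 1) := by
  have h := congrFun (MvPolynomial.coe_basisMonomials (Fin 3) k) d
  rw [coords, ← h, Basis.constr_basis]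

lemma coords_X_mul_of (i : Fin 3) (op : (ℕ × ℕ × ℕ → k) →ₗ[k] (ℕ × ℕ × ℕ → k))
    (h : ∀ d : Fin 3 →₀ ℕ, coords k (monomial (Finsupp.single i 1 + d) 1) =
      op (coords k (monomial d 1))) (f : MvP 3 k) : coords k (X i * f) = op (coords k f) := by
  have : (coords k).comp (LinearMap.mulLeft k (X i)) = op.comp (coords k) := by
    refine (basisMonomials (Fin 3) k).ext fun d => ?_
    simp only [LinearMap.comp_apply, LinearMap.mulLeft_apply, coe_basisMonomials]
    rw [← h, X, monomial_mul, one_mul]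
  exact LinearMap.congr_fun this f

lemma coords_X0_mul (f : MvP 3 k) : coords k (X 0 * f) = opX k (coords k f) := by
  refine coords_X_mul_of 0 _ (fun d => ?_) f
  have hc : Function.Commute (opX k) (opZ k) := fun F => (opX_opZ F).symm
  rw [coords_monomial, coords_monomial, (hc.iterate_right (d 2)).eq, opX_single]
  simp [add_comm]

lemma coords_X1_mul (f : MvP 3 k) : coords k (X 1 * f) = opY k (coords k f) := by
  refine coords_X_mul_of 1 _ (fun d => ?_) f
  have hc : Function.Commute (opY k) (opZ k) := fun F => (opY_opZ F).symm
  rw [coords_monomial, coords_monomial, (hc.iterate_right (d 2)).eq, opY_single]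
  simp [add_comm]

lemma coords_X2_mul (f : MvP 3 k) : coords k (X 2 * f) = opZ k (coords k f) := by
  refine coords_X_mul_of 2 _ (fun d => ?_) f
  rw [coords_monomial, coords_monomial, ← Function.iterate_succ_apply' (opZ k)]
  simp [add_comm]

lemma coords_X0_zero (f : MvP 3 k) (b c : ℕ) : coords k (X 0 * f) (0, b, c) = 0 := by
  rw [coords_X0_mul]; simp [opX]

lemma coords_X0_succ (f : MvP 3 k) (a b c : ℕ) :
    coords k (X 0 * f) (a + 1, b, c) = coords k f (a, b, c) := by
  rw [coords_X0_mul]; simp [opX]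

lemma coords_X1_zero (f : MvP 3 k) (a c : ℕ) : coords k (X 1 * f) (a, 0, c) = 0 := by
  rw [coords_X1_mul]; simp [opY]

lemma coords_X1_succ (f : MvP 3 k) (a b c : ℕ) :
    coords k (X 1 * f) (a, b + 1, c) = coords k f (a, b, c) := by
  rw [coords_X1_mul]; simp [opY]

lemma coords_X2 (f : MvP 3 k) (a b c : ℕ) :
    coords k (X 2 * f) (a, b, c) = (if c = 0 then 0 else coords k f (a, b, c - 1)) +
      (if a = 0 ∨ b = 0 then 0 else coords k f (a - 1, b - 1, c + 1)) := by
  rw [coords_X2_mul]; simp [opZ]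

lemma coords_bas (a b c : ℕ) : coords k (bas k a b (c + 1)) = Pi.single (a, b, c) 1 := by
  induction c using Nat.twoStepInduction generalizing a b with
  | zero =>
    have h : bas k a b 1 = monomial (Finsupp.single 0 a + Finsupp.single 1 b) 1 := by
      rw [bas, E3, cont, mul_one, X_pow_eq_monomial, X_pow_eq_monomial, monomial_mul, one_mul]
    rw [zero_add, h, coords_monomial]
    simp
  | one =>
    have h := X2_mul_bas (k := k) a b 0
    rw [bas_zero, add_zero] at h
    rw [← h, coords_X2_mul, ← opZ_single_zero]
    congr 1
    have h1 : bas k a b 1 = monomial (Finsupp.single 0 a + Finsupp.single 1 b) 1 := by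
      rw [bas, E3, cont, mul_one, X_pow_eq_monomial, X_pow_eq_monomial, monomial_mul, one_mul]
    rw [zero_add, h1, coords_monomial]
    simp
  | more c h0 h1 =>
    have h := X2_mul_bas (k := k) a b (c + 1)
    rw [← sub_eq_iff_eq_add] at h
    rw [← h, map_sub, coords_X2_mul, h1, h0, opZ_single_succ, add_sub_cancel_right]

lemma coords_bas_apply (a b c p q r : ℕ) :
    coords k (bas k a b c) (p, q, r) = if a = p ∧ b = q ∧ c = r + 1 then 1 else 0 := by
  rcases c with _ | c
  · simp [bas_zero]
  · rw [coords_bas, Pi.single_apply]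
    simp only [Prod.mk.injEq]
    split_ifs <;> first | rfl | omega

lemma mem_span_bas (f : MvP 3 k) :
    f ∈ Submodule.span k (Set.range fun p : ℕ × ℕ × ℕ => bas k p.1 p.2.1 (p.2.2 + 1)) := by
  have hb : ∀ a b c, bas k a b c ∈
      Submodule.span k (Set.range fun p : ℕ × ℕ × ℕ => bas k p.1 p.2.1 (p.2.2 + 1)) := by
    intro a b c
    rcases c with _ | c
    · rw [bas_zero]; exact zero_mem _
    · exact Submodule.subset_span ⟨(a, b, c), rfl⟩
  induction f using MvPolynomial.induction_on with
  | C r =>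
    have : (C r : MvP 3 k) = r • bas k 0 0 1 := by simp [bas, cont, smul_eq_C_mul]
    rw [this]
    exact Submodule.smul_mem _ _ (hb _ _ _)
  | add f g hf hg => exact add_mem hf hg
  | mul_X f i hf =>
    induction hf using Submodule.span_induction with
    | zero => simp
    | add f g _ _ hf hg => rw [add_mul]; exact add_mem hf hg
    | smul r f _ hf => rw [smul_mul_assoc]; exact Submodule.smul_mem _ _ hf
    | mem f hf =>
      obtain ⟨⟨a, b, c⟩, rfl⟩ := hf
      rw [mul_comm]
      fin_cases i
      · simp only [Fin.zero_eta, X0_mul_bas]; exact hb _ _ _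
      · simp only [Fin.mk_one, X1_mul_bas]; exact hb _ _ _
      · simp only [Fin.reduceFinMk, X2_mul_bas]; exact add_mem (hb _ _ _) (hb _ _ _)

/-- A polynomial lies in a subspace containing all the basis elements it involves. -/
lemma mem_of_coords (K : Submodule k (MvP 3 k)) (f : MvP 3 k)
    (h : ∀ a b c, coords k f (a, b, c) ≠ 0 → bas k a b (c + 1) ∈ K) : f ∈ K := by
  obtain ⟨l, hl⟩ := (Finsupp.mem_span_range_iff_exists_finsupp).1 (mem_span_bas f)
  have hc : ∀ p, coords k f p = l p := by
    intro p
    rw [← hl, Finsupp.sum, map_sum]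
    simp only [map_smul, coords_bas, Finset.sum_apply, Pi.smul_apply, Pi.single_apply,
      smul_eq_mul, mul_ite, mul_one, mul_zero, Prod.mk.eta]
    rw [Finset.sum_ite_eq]
    simp
  rw [← hl]
  refine Submodule.sum_mem _ fun p hp => Submodule.smul_mem _ _ (h _ _ _ ?_)
  rw [hc]
  exact Finsupp.mem_support_iff.1 hp

end Coordinates

section StandardMonomials

/-- The indices of the basis elements which survive in the quotient. -/
def Std (s a b c : ℕ) : Prop := (b + c < s ∧ a + c ≤ s) ∨ (a = 0 ∧ b = 0 ∧ c = s)

/-- The ideal of polynomials whose standard coordinates vanish. -/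
def coordIdeal (k : Type) [Field k] (s : ℕ) : Ideal (MvP 3 k) where
  carrier := {f | ∀ a b c, Std s a b c → coords k f (a, b, c) = 0}
  add_mem' := by
    intro f g hf hg a b c h
    rw [map_add, Pi.add_apply, hf a b c h, hg a b c h, add_zero]
  zero_mem' := by intro a b c _; simp
  smul_mem' := by
    intro r f hf
    rw [smul_eq_mul]
    induction r using MvPolynomial.induction_on generalizing f with
    | C r =>
      intro a b c h
      rw [← smul_eq_C_mul, map_smul, Pi.smul_apply, hf a b c h, smul_zero]
    | add p q hp hq =>
      intro a b c h
      rw [add_mul, map_add, Pi.add_apply, hp hf a b c h, hq hf a b c h, add_zero]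
    | mul_X p i hp =>
      rw [mul_assoc]
      refine hp ?_
      intro a b c h
      fin_cases i
      · rcases a with _ | a
        · exact coords_X0_zero _ _ _
        · exact (coords_X0_succ _ _ _ _).trans (hf _ _ _ (by unfold Std at *; omega))
      · rcases b with _ | b
        · exact coords_X1_zero _ _ _
        · exact (coords_X1_succ _ _ _ _).trans (hf _ _ _ (by unfold Std at *; omega))
      · refine (coords_X2 _ _ _ _).trans ?_
        split_ifs with h1 h2 h2
        · simp
        · rw [zero_add]; exact hf _ _ _ (by unfold Std at *; omega)
        · rw [add_zero]; exact hf _ _ _ (by unfold Std at *; omega)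
        · rw [hf _ _ _ (by unfold Std at *; omega), hf _ _ _ (by unfold Std at *; omega),
            add_zero]

lemma bas_mem_coordIdeal {s a b c : ℕ} (h : ¬ Std s a b c) :
    bas k a b (c + 1) ∈ coordIdeal k s := by
  intro p q r hs
  rw [coords_bas_apply, if_neg]
  rintro ⟨rfl, rfl, hc⟩
  obtain rfl : c = r := by omega
  exact h hs

lemma bas_add (a b a' b' c : ℕ) :
    bas k (a + a') (b + b') c = X 0 ^ a * X 1 ^ b * bas k a' b' c := by
  simp only [bas]; ring

lemma bas_mem_of_le {K : Ideal (MvP 3 k)} {a b a' b' c : ℕ} (h : bas k a b c ∈ K) (ha : a ≤ a')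
    (hb : b ≤ b') : bas k a' b' c ∈ K := by
  obtain ⟨p, rfl⟩ := Nat.exists_eq_add_of_le' ha
  obtain ⟨q, rfl⟩ := Nat.exists_eq_add_of_le' hb
  rw [bas_add]
  exact K.mul_mem_left _ h

lemma bas_add_two (a b c : ℕ) :
    bas k a b (c + 2) = X 2 * bas k a b (c + 1) - bas k (a + 1) (b + 1) c := by
  rw [X2_mul_bas, add_sub_cancel_right]

variable {s : ℕ} {K : Ideal (MvP 3 k)}

lemma bas_mem_of_y (hs : 2 ≤ s)
    (hy : ∀ b c, 1 ≤ b → b + c = s → bas k 0 b (c + 1) ∈ K) (n a b : ℕ) (hb : 1 ≤ b)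
    (hn : s + 1 ≤ b + n) : bas k a b n ∈ K := by
  induction n using Nat.strong_induction_on generalizing a b with
  | _ n ih =>
    rcases n with _ | c
    · rw [bas_zero]; exact zero_mem _
    · by_cases hc : c < s
      · exact bas_mem_of_le (hy (s - c) c (by omega) (by omega)) (by omega) (by omega)
      · obtain ⟨c, rfl⟩ : ∃ d, c = d + 1 := ⟨c - 1, by omega⟩
        rw [bas_add_two]
        exact sub_mem (K.mul_mem_left _ (ih (c + 1) (by omega) a b hb (by omega)))
          (ih c (by omega) _ _ (by omega) (by omega))

lemma bas_mem_of_x (hs : 2 ≤ s)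
    (hy : ∀ b c, 1 ≤ b → b + c = s → bas k 0 b (c + 1) ∈ K)
    (hx : ∀ a c, c < s → a + c = s + 1 → bas k a 0 (c + 1) ∈ K)
    (hxs : X 0 * bas k 0 0 (s + 1) ∈ K) (hzs : X 2 * bas k 0 0 (s + 1) ∈ K)
    (n a b : ℕ) (hn : s + 2 ≤ a + n) : bas k a b n ∈ K := by
  induction n using Nat.strong_induction_on generalizing a b with
  | _ n ih =>
    rcases n with _ | c
    · rw [bas_zero]; exact zero_mem _
    · rcases lt_trichotomy c s with hc | rfl | hc
      · exact bas_mem_of_le (hx (s + 1 - c) c hc (by omega)) (by omega) (by omega)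
      · rw [X0_mul_bas] at hxs
        exact bas_mem_of_le hxs (by omega) (by omega)
      · obtain ⟨c, rfl⟩ : ∃ d, c = d + 1 := ⟨c - 1, by omega⟩
        refine bas_mem_of_le (a := 0) (b := 0) ?_ (by omega) (by omega)
        rw [bas_add_two]
        refine sub_mem ?_ (bas_mem_of_y hs hy _ _ _ (by omega) (by omega))
        rcases Nat.lt_or_ge s c with hsc | hsc
        · exact K.mul_mem_left _ (ih (c + 1) (by omega) 0 0 (by omega))
        · obtain rfl : c = s := by omega
          exact hzs

lemma eq_coordIdeal (hs : 2 ≤ s) (hK : K ≤ coordIdeal k s)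
    (hy : ∀ b c, 1 ≤ b → b + c = s → bas k 0 b (c + 1) ∈ K)
    (hx : ∀ a c, c < s → a + c = s + 1 → bas k a 0 (c + 1) ∈ K)
    (hxs : X 0 * bas k 0 0 (s + 1) ∈ K) (hzs : X 2 * bas k 0 0 (s + 1) ∈ K) :
    K = coordIdeal k s := by
  refine le_antisymm hK fun f hf => ?_
  refine mem_of_coords (K.restrictScalars k) f fun a b c h => ?_
  have hstd : ¬ Std s a b c := fun h' => h (hf a b c h')
  unfold Std at hstd
  rw [Submodule.restrictScalars_mem]
  rcases Nat.lt_or_ge (b + c) s with h1 | h1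
  · exact bas_mem_of_x hs hy hx hxs hzs _ _ _ (by omega)
  · rcases Nat.eq_zero_or_pos b with rfl | hb
    · exact bas_mem_of_x hs hy hx hxs hzs _ _ _ (by omega)
    · exact bas_mem_of_y hs hy _ _ _ hb (by omega)

lemma X_mul_mem_coordIdeal (hs : 2 ≤ s) (i : Fin 3) :
    X i * bas k 0 0 (s + 1) ∈ coordIdeal k s := by
  fin_cases i
  · simp only [Fin.zero_eta, X0_mul_bas]
    exact bas_mem_coordIdeal (by unfold Std; omega)
  · simp only [Fin.mk_one, X1_mul_bas]
    exact bas_mem_coordIdeal (by unfold Std; omega)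
  · simp only [Fin.reduceFinMk, X2_mul_bas]
    obtain ⟨s, rfl⟩ : ∃ d, s = d + 1 := ⟨s - 1, by omega⟩
    exact add_mem (bas_mem_coordIdeal (by unfold Std; omega))
      (bas_mem_coordIdeal (by unfold Std; omega))

lemma neg_or_mem_iff {R : Type} [CommRing R] (J : Ideal R) {a b : R} (h : a = b ∨ a = -b) :
    a ∈ J ↔ b ∈ J := by
  rcases h with rfl | rfl
  · rfl
  · exact neg_mem_iff

theorem trimPf_eq_coordIdeal (hs : 2 ≤ s) (hlt : s < 2 * s + 1) :
    trimPf (Vmat k s) ⟨s, hlt⟩ (irrIdeal 3 k) = coordIdeal k s := by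
  have hle : ∀ (j d : ℕ) (h : j + d = s) (J : Ideal (MvP 3 k)),
      subPf (Vmat k s) ⟨j, by omega⟩ ∈ J ↔ bas k 0 d (j + 1) ∈ J := by
    rintro j d rfl J
    rw [neg_or_mem_iff J (subPf_Vmat_le j d), bas, pow_zero, one_mul]
  have hgt : ∀ (c d : ℕ) (h : c + d = s) (hd : 0 < d) (J : Ideal (MvP 3 k)),
      subPf (Vmat k s) ⟨c + 2 * d, by omega⟩ ∈ J ↔ bas k (d + 1) 0 (c + 1) ∈ J := by
    rintro c d rfl hd J
    rw [neg_or_mem_iff J (subPf_Vmat_gt c d hd), bas, pow_zero, mul_one]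
  have hmid : ∀ i : Fin 3, ∀ J : Ideal (MvP 3 k),
      X i * subPf (Vmat k s) ⟨s, by omega⟩ ∈ J ↔ X i * bas k 0 0 (s + 1) ∈ J := by
    intro i J
    refine neg_or_mem_iff J ?_
    have h : subPf (Vmat k s) ⟨s, by omega⟩ = X 1 ^ 0 * E3 k (s + 1) ∨
        subPf (Vmat k s) ⟨s, by omega⟩ = -(X 1 ^ 0 * E3 k (s + 1)) := subPf_Vmat_le s 0
    simp only [bas, pow_zero, one_mul] at h ⊢
    rcases h with h | h <;> simp [h]
  have hX : ∀ i : Fin 3, X i * subPf (Vmat k s) ⟨s, by omega⟩ ∈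
      trimPf (Vmat k s) ⟨s, by omega⟩ (irrIdeal 3 k) := fun i =>
    Ideal.mem_sup_right (Ideal.mul_mem_mul (Ideal.subset_span ⟨i, rfl⟩)
      (Ideal.subset_span rfl))
  refine eq_coordIdeal hs ?_ ?_ ?_ ((hmid 0 _).1 (hX 0)) ((hmid 2 _).1 (hX 2))
  · refine sup_le (Ideal.span_le.2 ?_) ?_
    · rintro _ ⟨⟨j, hj⟩, hne, rfl⟩
      have hne' : j ≠ s := fun h => hne (Fin.ext h)
      rcases Nat.lt_or_ge j s with h | h
      · exact (hle j (s - j) (by omega) _).2 (bas_mem_coordIdeal (by unfold Std; omega))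
      · have := (hgt (2 * s - j) (j - s) (by omega) (by omega) (coordIdeal k s)).2
          (bas_mem_coordIdeal (by unfold Std; omega))
        rw [show (⟨j, hj⟩ : Fin (2 * s + 1)) = ⟨2 * s - j + 2 * (j - s), by omega⟩ from
          Fin.ext (by simp; omega)]
        exact this
    · rw [irrIdeal, Ideal.span_mul_span', Ideal.span_le]
      rintro _ ⟨_, ⟨i, rfl⟩, _, rfl, rfl⟩
      exact (hmid i _).2 (X_mul_mem_coordIdeal hs i)
  · intro b c hb hbc
    refine (hle c b (by omega) _).1 (Ideal.mem_sup_left (Ideal.subset_span ⟨_, ?_, rfl⟩))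
    simp [Fin.ext_iff]; omega
  · intro a c hc hac
    obtain ⟨d, rfl⟩ : ∃ d, a = d + 1 := ⟨a - 1, by omega⟩
    refine (hgt c d (by omega) (by omega) _).1
      (Ideal.mem_sup_left (Ideal.subset_span ⟨_, ?_, rfl⟩))
    simp [Fin.ext_iff]; omega

end StandardMonomials

section Generators

/-- The exponent of `x` in the `T₁`-cycles supported at the first Koszul generator. -/
def aIdx (s i : ℕ) : ℕ := if i < 2 * s - 1 then i - s + 2 else 2 * s - i

/-- Minimal generators of the ideal. -/
def gen (k : Type) [Field k] (s i : ℕ) : MvP 3 k :=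
  if i < s then bas k 0 (i + 1) (s - i)
  else if i ≤ 2 * s then bas k (aIdx s i + 1) 0 (s + 1 - aIdx s i)
  else X 2 * bas k 0 0 (s + 1)

/-- The coordinate detecting the `i`-th minimal generator. -/
def genIdx (s i : ℕ) : ℕ × ℕ × ℕ :=
  if i < s then (0, i + 1, s - 1 - i)
  else if i ≤ 2 * s then (aIdx s i + 1, 0, s - aIdx s i)
  else (0, 0, s + 1)

variable {s : ℕ}

lemma coords_gen (hs : 2 ≤ s) {i j : ℕ} (hi : i < 2 * s + 2) (hj : j < 2 * s + 2) :
    coords k (gen k s i) (genIdx s j) = if i = j then 1 else 0 := by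
  unfold gen genIdx aIdx
  split_ifs <;> first
    | omega
    | (rw [X2_mul_bas, map_add, Pi.add_apply, coords_bas_apply, coords_bas_apply]
       split_ifs <;> first | omega | tauto | simp)
    | (rw [coords_bas_apply]
       split_ifs <;> first | omega | tauto)

lemma coords_X_mul_genIdx (hs : 2 ≤ s) {f : MvP 3 k} (hf : f ∈ coordIdeal k s) (l : Fin 3)
    (j : ℕ) : coords k (X l * f) (genIdx s j) = 0 := by
  unfold genIdx
  split_ifs with h1 h2
  · fin_cases l
    · exact coords_X0_zero _ _ _
    · exact (coords_X1_succ _ _ _ _).trans (hf _ _ _ (by unfold Std; omega))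
    · refine (coords_X2 _ _ _ _).trans ?_
      rw [if_pos (Or.inl rfl), add_zero]
      split_ifs
      · rfl
      · exact hf _ _ _ (by unfold Std; omega)
  · have hA : aIdx s j ≤ s := by unfold aIdx; split_ifs <;> omega
    fin_cases l
    · exact (coords_X0_succ _ _ _ _).trans (hf _ _ _ (by unfold Std; omega))
    · exact coords_X1_zero _ _ _
    · refine (coords_X2 _ _ _ _).trans ?_
      rw [if_pos (Or.inr rfl), add_zero]
      split_ifs
      · rfl
      · exact hf _ _ _ (by unfold Std; omega)
  · fin_cases l
    · exact coords_X0_zero _ _ _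
    · exact coords_X1_zero _ _ _
    · refine (coords_X2 _ _ _ _).trans ?_
      rw [if_pos (Or.inr rfl), add_zero, if_neg (by omega)]
      exact hf _ _ _ (by unfold Std; omega)

lemma exists_eq_C_add (r : MvP 3 k) :
    ∃ (c : k) (p : Fin 3 → MvP 3 k), r = C c + ∑ l, X l * p l := by
  induction r using MvPolynomial.induction_on with
  | C c => exact ⟨c, 0, by simp⟩
  | add f g hf hg =>
    obtain ⟨c, p, rfl⟩ := hf
    obtain ⟨d, q, rfl⟩ := hg
    refine ⟨c + d, p + q, ?_⟩
    simp only [map_add, Pi.add_apply, mul_add, Finset.sum_add_distrib]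
    ring
  | mul_X f i _ =>
    refine ⟨0, Pi.single i f, ?_⟩
    rw [Finset.sum_eq_single i (fun l _ hl => by simp [hl]) (by simp)]
    simp [mul_comm]

lemma span_gen (hs : 2 ≤ s) :
    Ideal.span (Set.range fun i : Fin (2 * s + 2) => gen k s i) = coordIdeal k s := by
  have hg : ∀ i (_ : i < 2 * s + 2), gen k s i ∈
      Ideal.span (Set.range fun i : Fin (2 * s + 2) => gen k s i) :=
    fun i hi => Ideal.subset_span ⟨⟨i, hi⟩, rfl⟩
  refine eq_coordIdeal hs ?_ ?_ ?_ ?_ ?_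
  · rw [Ideal.span_le]
    rintro _ ⟨⟨i, hi⟩, rfl⟩
    simp only [gen]
    split_ifs with h1 h2
    · obtain ⟨c, hc⟩ : ∃ c, s - i = c + 1 := ⟨s - i - 1, by omega⟩
      rw [hc]
      exact bas_mem_coordIdeal (by unfold Std; omega)
    · have hA : aIdx s i ≤ s := by unfold aIdx; split_ifs <;> omega
      obtain ⟨c, hc⟩ : ∃ c, s + 1 - aIdx s i = c + 1 := ⟨s - aIdx s i, by omega⟩
      rw [hc]
      exact bas_mem_coordIdeal (by unfold Std; omega)
    · exact X_mul_mem_coordIdeal hs 2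
  · intro b c hb hbc
    have h := hg (b - 1) (by omega)
    rwa [gen, if_pos (by omega), show b - 1 + 1 = b by omega, show s - (b - 1) = c + 1 by omega]
      at h
  · intro a c hc hac
    rcases Nat.lt_or_ge 2 a with ha | ha
    · have h := hg (a + s - 3) (by omega)
      have hA : aIdx s (a + s - 3) = a - 1 := by unfold aIdx; rw [if_pos (by omega)]; omega
      rwa [gen, if_neg (by omega), if_pos (by omega), hA, show a - 1 + 1 = a by omega,
        show s + 1 - (a - 1) = c + 1 by omega] at h
    · have h := hg (2 * s - 1) (by omega)
      have hA : aIdx s (2 * s - 1) = a - 1 := by unfold aIdx; rw [if_neg (by omega)]; omega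
      rwa [gen, if_neg (by omega), if_pos (by omega), hA, show a - 1 + 1 = a by omega,
        show s + 1 - (a - 1) = c + 1 by omega] at h
  · have h := hg (2 * s) (by omega)
    have hA : aIdx s (2 * s) = 0 := by unfold aIdx; rw [if_neg (by omega)]; omega
    rw [gen, if_neg (by omega), if_pos (by omega), hA] at h
    rw [X0_mul_bas]
    exact h
  · have h := hg (2 * s + 1) (by omega)
    rwa [gen, if_neg (by omega), if_neg (by omega)] at h

/-- The functionals dual to the minimal generators. -/
def genDual (k : Type) [Field k] (s : ℕ) : MvP 3 k →ₗ[k] (Fin (2 * s + 2) → k) :=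
  LinearMap.pi fun j => (LinearMap.proj (genIdx s j)).comp (coords k)

lemma genDual_X_mul (hs : 2 ≤ s) {f : MvP 3 k} (hf : f ∈ coordIdeal k s) (l : Fin 3) :
    genDual k s (X l * f) = 0 := by
  ext j
  exact coords_X_mul_genIdx hs hf l j

lemma genDual_gen (hs : 2 ≤ s) (i : Fin (2 * s + 2)) :
    genDual k s (gen k s i) = Pi.single i 1 := by
  ext j
  refine (coords_gen hs i.2 j.2).trans ?_
  simp [Pi.single_apply, Fin.ext_iff, eq_comm]

lemma genDual_mem_span (hs : 2 ≤ s) {ι : Type} (f : ι → MvP 3 k)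
    (hf : Ideal.span (Set.range f) = coordIdeal k s) {p : MvP 3 k} (hp : p ∈ coordIdeal k s) :
    genDual k s p ∈ Submodule.span k (Set.range fun i => genDual k s (f i)) := by
  rw [← hf] at hp
  induction hp using Submodule.span_induction with
  | zero => simp
  | add p q _ _ hp hq => rw [map_add]; exact add_mem hp hq
  | mem p hp =>
    obtain ⟨i, rfl⟩ := hp
    exact Submodule.subset_span ⟨i, rfl⟩
  | smul r p hpm hp =>
    obtain ⟨c, q, rfl⟩ := exists_eq_C_add r
    replace hpm : p ∈ coordIdeal k s := hf ▸ hpm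
    rw [smul_eq_mul, add_mul, map_add, ← smul_eq_C_mul, map_smul, Finset.sum_mul, map_sum,
      Finset.sum_eq_zero, add_zero]
    · exact Submodule.smul_mem _ _ hp
    · intro l _
      rw [mul_assoc]
      exact genDual_X_mul hs (Ideal.mul_mem_left _ _ hpm) l

theorem mu_coordIdeal (hs : 2 ≤ s) : mu (coordIdeal k s) = 2 * s + 2 := by
  refine le_antisymm (Nat.sInf_le ⟨_, span_gen hs⟩) ?_
  refine le_csInf ⟨_, _, span_gen hs⟩ ?_
  rintro m ⟨f, hf⟩
  have htop : (⊤ : Submodule k (Fin (2 * s + 2) → k)) ≤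
      Submodule.span k (Set.range fun i => genDual k s (f i)) := by
    rw [← (Pi.basisFun k (Fin (2 * s + 2))).span_eq, Submodule.span_le]
    rintro _ ⟨i, rfl⟩
    rw [Pi.basisFun_apply, ← genDual_gen hs]
    refine genDual_mem_span hs f hf ?_
    rw [← span_gen hs]
    exact Ideal.subset_span ⟨i, rfl⟩
  have h := finrank_range_le_card (R := k) fun i => genDual k s (f i)
  rw [Set.finrank, top_le_iff.1 htop, finrank_top] at h
  simpa using h

end Generators

section FirstTor

lemma kosd1_mk (I : Ideal (MvP 3 k)) (u : Fin 3 → MvP 3 k) :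
    kosd1 I (fun l => Ideal.Quotient.mk I (u l)) = Ideal.Quotient.mk I (∑ l, X l * u l) := by
  simp [kosd1, xq, map_sum, map_mul]

lemma mk_crossProduct (I : Ideal (MvP 3 k)) (u v : Fin 3 → MvP 3 k) (l : Fin 3) :
    crossProduct (fun l => Ideal.Quotient.mk I (u l)) (fun l => Ideal.Quotient.mk I (v l)) l =
      Ideal.Quotient.mk I (crossProduct u v l) := by
  fin_cases l <;> simp [cross_apply]

lemma kosd2_mk (I : Ideal (MvP 3 k)) (u : Fin 3 → MvP 3 k) (l : Fin 3) :
    kosd2 I (fun l => Ideal.Quotient.mk I (u l)) l =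
      Ideal.Quotient.mk I (crossProduct (fun l => (X l : MvP 3 k)) u l) :=
  mk_crossProduct I _ u l

lemma exists_lift (I : Ideal (MvP 3 k)) (u : Fin 3 → MvP 3 k ⧸ I) :
    ∃ v : Fin 3 → MvP 3 k, u = fun l => Ideal.Quotient.mk I (v l) := by
  choose v hv using fun l => Ideal.Quotient.mk_surjective (u l)
  exact ⟨v, funext fun l => (hv l).symm⟩

lemma sum_smul_mk (I : Ideal (MvP 3 k)) {ι : Type} [Fintype ι] (c : ι → k)
    (u : ι → Fin 3 → MvP 3 k) :
    ∑ i, c i • (fun l => Ideal.Quotient.mk I (u i l)) =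
      fun l => Ideal.Quotient.mk I (∑ i, c i • u i l) := by
  ext l
  rw [Finset.sum_apply, map_sum]
  exact Finset.sum_congr rfl fun i _ => (map_smul (Ideal.Quotient.mkₐ k I) (c i) (u i l)).symm

lemma X_dot_crossProduct (v : Fin 3 → MvP 3 k) :
    ∑ l, X l * crossProduct (fun l => (X l : MvP 3 k)) v l = 0 := by
  simp [cross_apply, Fin.sum_univ_three]
  ring

lemma koszul_exact {u : Fin 3 → MvP 3 k} (h : ∑ l, X l * u l = 0) :
    ∃ v, u = crossProduct (fun l => (X l : MvP 3 k)) v := by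
  rw [Fin.sum_univ_three] at h
  have hmem : X 2 * u 2 ∈ Ideal.span (X '' ({0, 1} : Set (Fin 3)) : Set (MvP 3 k)) := by
    rw [show X 2 * u 2 = -u 0 * X 0 + -u 1 * X 1 by linear_combination h]
    exact add_mem (Ideal.mul_mem_left _ _ (Ideal.subset_span ⟨0, by simp, rfl⟩))
      (Ideal.mul_mem_left _ _ (Ideal.subset_span ⟨1, by simp, rfl⟩))
  have hmem2 : u 2 ∈ Ideal.span (X '' ({0, 1} : Set (Fin 3)) : Set (MvP 3 k)) := by
    rw [mem_ideal_span_X_image] at hmem ⊢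
    intro m hm
    obtain ⟨i, hi, h0⟩ := hmem (Finsupp.single 2 1 + m) (by
      rw [MvPolynomial.mem_support_iff, mul_comm, add_comm, coeff_mul_X]
      exact MvPolynomial.mem_support_iff.1 hm)
    refine ⟨i, hi, ?_⟩
    rcases hi with rfl | rfl <;> simpa using h0
  rw [Set.image_pair, Ideal.mem_span_pair] at hmem2
  obtain ⟨p, q, hpq⟩ := hmem2
  have h2 : X 0 * (u 0 + X 2 * p) + X 1 * (u 1 + X 2 * q) = 0 := by
    linear_combination h + X 2 * hpq
  have hdvd : (X 0 : MvP 3 k) ∣ X 1 * (u 1 + X 2 * q) :=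
    ⟨-(u 0 + X 2 * p), by linear_combination h2⟩
  have hprime : Prime (X 0 : MvP 3 k) := X_prime
  rcases hprime.dvd_or_dvd hdvd with hd | ⟨r, hr⟩
  · rw [X_dvd_X] at hd
    simp at hd
  · have hr2 : u 0 + X 2 * p = - (X 1 * r) := by
      refine mul_left_cancel₀ hprime.ne_zero ?_
      linear_combination h2 - X 1 * hr
    refine ⟨![-q, p, -r], ?_⟩
    ext1 l
    fin_cases l
    · simp [cross_apply]; linear_combination hr2
    · simp [cross_apply]; linear_combination hr
    · simp [cross_apply]; linear_combination -hpq

/-- Lifts of cycles representing a basis of `T₁`. -/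
def cyc1 (k : Type) [Field k] (s i : ℕ) : Fin 3 → MvP 3 k :=
  if i < s then ![0, bas k 0 i (s - i), 0]
  else if i ≤ 2 * s then ![bas k (aIdx s i) 0 (s + 1 - aIdx s i), 0, 0]
  else ![0, 0, bas k 0 0 (s + 1)]

lemma sum_X_mul_cyc1 (s i : ℕ) : ∑ l, X l * cyc1 k s i l = gen k s i := by
  rw [Fin.sum_univ_three]
  unfold cyc1 gen
  split_ifs <;> simp [X0_mul_bas, X1_mul_bas]

variable {s : ℕ}

lemma gen_mem (hs : 2 ≤ s) (i : Fin (2 * s + 2)) : gen k s i ∈ coordIdeal k s := by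
  rw [← span_gen hs]
  exact Ideal.subset_span ⟨i, rfl⟩

lemma cyc1_mem_ker (hs : 2 ≤ s) (i : Fin (2 * s + 2)) :
    (fun l => Ideal.Quotient.mk (coordIdeal k s) (cyc1 k s i l)) ∈
      LinearMap.ker (kosd1 (coordIdeal k s)) := by
  rw [LinearMap.mem_ker, kosd1_mk, sum_X_mul_cyc1, Ideal.Quotient.eq_zero_iff_mem]
  exact gen_mem hs i

lemma ker_kosd1_le (hs : 2 ≤ s) : LinearMap.ker (kosd1 (coordIdeal k s)) ≤
    Submodule.span k (Set.range fun i : Fin (2 * s + 2) => fun l =>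
      Ideal.Quotient.mk (coordIdeal k s) (cyc1 k s i l)) ⊔
      LinearMap.range (kosd2 (coordIdeal k s)) := by
  intro u hu
  obtain ⟨u, rfl⟩ := exists_lift _ u
  rw [LinearMap.mem_ker, kosd1_mk, Ideal.Quotient.eq_zero_iff_mem, ← span_gen hs,
    Ideal.mem_span_range_iff_exists_fun] at hu
  obtain ⟨r, hr⟩ := hu
  choose c p hp using fun i => exists_eq_C_add (r i)
  obtain ⟨v, hv⟩ := koszul_exact (u := fun l => u l - ∑ i, c i • cyc1 k s (i : Fin (2 * s + 2)) l -
      ∑ i : Fin (2 * s + 2), p i l * gen k s i) (by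
    simp only [mul_sub, Finset.sum_sub_distrib]
    rw [← hr]
    simp only [Finset.mul_sum]
    rw [Finset.sum_comm, Finset.sum_comm (s := Finset.univ (α := Fin 3)), ← Finset.sum_sub_distrib,
      ← Finset.sum_sub_distrib]
    refine Finset.sum_eq_zero fun i _ => ?_
    rw [hp i, ← sum_X_mul_cyc1]
    simp only [Fin.sum_univ_three, smul_eq_C_mul]
    ring)
  refine Submodule.mem_sup.2 ⟨∑ i, c i • fun l =>
      Ideal.Quotient.mk (coordIdeal k s) (cyc1 k s (i : Fin (2 * s + 2)) l), ?_,
      _, ⟨fun l => Ideal.Quotient.mk _ (v l), rfl⟩, ?_⟩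
  · exact Submodule.sum_mem _ fun i _ => Submodule.smul_mem _ _ (Submodule.subset_span ⟨i, rfl⟩)
  · rw [sum_smul_mk]
    ext l
    rw [Pi.add_apply, kosd2_mk, ← map_add, ← congrFun hv l, Ideal.Quotient.eq]
    rw [show ∀ a b c : MvP 3 k, a + (b - a - c) - b = -c by intros; ring]
    exact neg_mem (Ideal.sum_mem _ fun i _ => Ideal.mul_mem_left _ _ (gen_mem hs i))

lemma cyc1_independent (hs : 2 ≤ s) (c : Fin (2 * s + 2) → k)
    (h : (∑ i, c i • fun l => Ideal.Quotient.mk (coordIdeal k s) (cyc1 k s i l)) ∈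
      LinearMap.range (kosd2 (coordIdeal k s))) : c = 0 := by
  obtain ⟨v, hv⟩ := h
  obtain ⟨v, rfl⟩ := exists_lift _ v
  rw [sum_smul_mk] at hv
  have hmem : ∀ l, (∑ i, c i • cyc1 k s i l) -
      crossProduct (fun l => (X l : MvP 3 k)) v l ∈ coordIdeal k s := by
    intro l
    rw [← Ideal.Quotient.eq, ← kosd2_mk, hv]
  have hsum : ∑ i, c i • gen k s i = ∑ l, X l * ((∑ i, c i • cyc1 k s i l) -
      crossProduct (fun l => (X l : MvP 3 k)) v l) := by
    simp only [mul_sub, Finset.sum_sub_distrib, X_dot_crossProduct, sub_zero, Finset.mul_sum]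
    rw [Finset.sum_comm]
    refine Finset.sum_congr rfl fun i _ => ?_
    rw [← sum_X_mul_cyc1, Finset.smul_sum]
    exact Finset.sum_congr rfl fun l _ => (mul_smul_comm _ _ _).symm
  have h0 := congrArg (genDual k s) hsum
  rw [map_sum, map_sum, Finset.sum_eq_zero (s := Finset.univ (α := Fin 3))
    (fun l _ => genDual_X_mul hs (hmem l) l)] at h0
  simp only [map_smul, genDual_gen hs] at h0
  ext i
  have := congrFun h0 i
  simpa [Finset.sum_apply, Pi.single_apply] using this

end FirstTor

section ThirdTor

/-- The top socle element. -/
abbrev socTop (k : Type) [Field k] (s : ℕ) : MvP 3 k := bas k s (s - 1) 1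

variable {s : ℕ}

lemma socTop_X_mul (i : Fin 3) : X i * socTop k s ∈ coordIdeal k s := by
  fin_cases i
  · simp only [Fin.zero_eta, X0_mul_bas]
    exact bas_mem_coordIdeal (by unfold Std; omega)
  · simp only [Fin.mk_one, X1_mul_bas]
    exact bas_mem_coordIdeal (by unfold Std; omega)
  · simp only [Fin.reduceFinMk, X2_mul_bas, bas_zero, add_zero]
    exact bas_mem_coordIdeal (by unfold Std; omega)

/-- Modulo the ideal, every socle element is a combination of the two standard ones. -/
lemma socle_decomp (hs : 2 ≤ s) {f : MvP 3 k} (hf : ∀ i, X i * f ∈ coordIdeal k s) :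
    f - coords k f (s, s - 1, 0) • socTop k s - coords k f (0, 0, s) • bas k 0 0 (s + 1) ∈
      coordIdeal k s := by
  have hx : ∀ a b c, a + c < s → b + c < s → coords k f (a, b, c) = 0 := by
    intro a b c ha hb
    rw [← coords_X0_succ]
    exact hf 0 _ _ _ (by unfold Std; omega)
  intro a b c h
  rw [map_sub, map_sub, map_smul, map_smul]
  simp only [Pi.sub_apply, Pi.smul_apply, coords_bas_apply, smul_eq_mul]
  by_cases h1 : s = a ∧ s - 1 = b ∧ 1 = c + 1
  · obtain ⟨rfl, rfl, hc⟩ := h1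
    obtain rfl : c = 0 := by omega
    rw [if_pos (by omega), if_neg (by omega)]
    ring
  rw [if_neg h1]
  by_cases h2 : 0 = a ∧ 0 = b ∧ s + 1 = c + 1
  · obtain ⟨rfl, rfl, hc⟩ := h2
    obtain rfl : s = c := by omega
    rw [if_pos (by omega)]
    ring
  rw [if_neg h2, mul_zero, mul_zero, sub_zero, sub_zero]
  have h3 : b + c < s ∧ a + c ≤ s := by unfold Std at h; omega
  by_cases h4 : a + c < s
  · exact hx a b c h4 h3.1
  by_cases h5 : b + 1 + c < s
  · rw [← coords_X1_succ]
    exact hf 1 _ _ _ (by unfold Std; omega)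
  have hz := hf 2 (a + 1) (b + 1) (c - 1) (by unfold Std; omega)
  rw [coords_X2, if_neg (by omega : ¬ (a + 1 = 0 ∨ b + 1 = 0)), Nat.add_sub_cancel,
    Nat.add_sub_cancel, Nat.sub_add_cancel (by omega)] at hz
  by_cases hc : c - 1 = 0
  · rwa [if_pos hc, zero_add] at hz
  · rwa [if_neg hc, hx _ _ _ (by omega) (by omega), zero_add] at hz

/-- The standard basis of the socle. -/
def socBasis (k : Type) [Field k] (s : ℕ) : Fin 2 → MvP 3 k ⧸ coordIdeal k s :=
  ![Ideal.Quotient.mk _ (socTop k s), Ideal.Quotient.mk _ (bas k 0 0 (s + 1))]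

lemma socBasis_mem_ker (hs : 2 ≤ s) (i : Fin 2) :
    socBasis k s i ∈ LinearMap.ker (kosd3 (coordIdeal k s)) := by
  rw [LinearMap.mem_ker]
  ext l
  fin_cases i
  · exact Ideal.Quotient.eq_zero_iff_mem.2 (socTop_X_mul l)
  · exact Ideal.Quotient.eq_zero_iff_mem.2 (X_mul_mem_coordIdeal hs l)

lemma ker_kosd3_le (hs : 2 ≤ s) :
    LinearMap.ker (kosd3 (coordIdeal k s)) ≤ Submodule.span k (Set.range (socBasis k s)) := by
  intro f hf
  obtain ⟨f, rfl⟩ := Ideal.Quotient.mk_surjective f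
  have h := socle_decomp hs (f := f) fun i => by
    rw [← Ideal.Quotient.eq_zero_iff_mem, map_mul]
    exact congrFun hf i
  rw [sub_sub, ← Ideal.Quotient.eq] at h
  rw [h, map_add]
  refine add_mem ?_ ?_
  · exact Submodule.smul_mem (Submodule.span k (Set.range (socBasis k s))) (coords k f (s, s - 1, 0))
      (Submodule.subset_span ⟨0, rfl⟩)
  · exact Submodule.smul_mem (Submodule.span k (Set.range (socBasis k s))) (coords k f (0, 0, s))
      (Submodule.subset_span ⟨1, rfl⟩)

lemma socBasis_linearIndependent (hs : 2 ≤ s) : LinearIndependent k (socBasis k s) := by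
  rw [socBasis, LinearIndependent.pair_iff]
  intro a b h
  have h' : a • socTop k s + b • bas k 0 0 (s + 1) ∈ coordIdeal k s :=
    Ideal.Quotient.eq_zero_iff_mem.1 h
  constructor
  · have := h' s (s - 1) 0 (by unfold Std; omega)
    rw [map_add, map_smul, map_smul] at this
    simp only [Pi.add_apply, Pi.smul_apply] at this
    rw [coords_bas_apply, coords_bas_apply, if_pos (by omega), if_neg (by omega)] at this
    simpa using this
  · have := h' 0 0 s (by unfold Std; omega)
    rw [map_add, map_smul, map_smul] at this
    simp only [Pi.add_apply, Pi.smul_apply] at this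
    rw [coords_bas_apply, coords_bas_apply, if_neg (by omega), if_pos (by omega)] at this
    simpa using this

lemma finrank_ker_kosd3 (hs : 2 ≤ s) :
    finrank k (LinearMap.ker (kosd3 (coordIdeal k s))) = 2 := by
  rw [show LinearMap.ker (kosd3 (coordIdeal k s)) = Submodule.span k (Set.range (socBasis k s))
    from le_antisymm (ker_kosd3_le hs) (Submodule.span_le.2 ?_),
    finrank_span_eq_card (socBasis_linearIndependent hs)]
  · simp
  · rintro _ ⟨i, rfl⟩
    exact socBasis_mem_ker hs i

lemma socle_eq_ker (I : Ideal (MvP 3 k)) : socle I = LinearMap.ker (kosd3 I) := by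
  ext f
  exact ⟨fun h => funext h, fun h i => congrFun h i⟩

end ThirdTor

section Products

/-- Lifts of cycles representing a basis of `T₂`. -/
def cyc2 (k : Type) [Field k] (s i : ℕ) : Fin 3 → MvP 3 k :=
  if i < s then ![0, bas k (i + 1) 0 (s - i), bas k (i + 2) 0 (s - 1 - i)]
  else if i < 2 * s - 1 then
    ![bas k 0 (i - s + 1) (2 * s - 1 - i), 0, bas k 0 (i - s + 2) (2 * s - 2 - i)]
  else if i = 2 * s - 1 then ![0, 0, bas k 1 0 s]
  else if i = 2 * s then ![bas k 0 0 (s + 1), 0, 0]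
  else if i = 2 * s + 1 then ![0, bas k 0 0 (s + 1), 0]
  else ![0, 0, bas k 0 0 (s + 1)]

variable {s : ℕ}

lemma bas_mem {a b c : ℕ} (h : ∀ d, c = d + 1 → ¬ Std s a b d) : bas k a b c ∈ coordIdeal k s := by
  rcases c with _ | c
  · rw [bas_zero]; exact zero_mem _
  · exact bas_mem_coordIdeal (h c rfl)

lemma bas_mul_top_mem (hs : 2 ≤ s) {a b c : ℕ} (h : 0 < a ∨ 0 < b ∨ c ≠ 1) :
    bas k a b c * bas k 0 0 (s + 1) ∈ coordIdeal k s := by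
  have hX : ∀ i (p : MvP 3 k), X i * p * bas k 0 0 (s + 1) ∈ coordIdeal k s := by
    intro i p
    rw [mul_right_comm]
    exact Ideal.mul_mem_right _ _ (X_mul_mem_coordIdeal hs i)
  rcases a with _ | a
  · rcases b with _ | b
    · rcases c with _ | _ | c
      · rw [bas_zero, zero_mul]; exact zero_mem _
      · omega
      · rw [bas_add_two, ← X0_mul_bas, sub_mul]
        exact sub_mem (hX _ _) (hX _ _)
    · rw [← X1_mul_bas]; exact hX _ _
  · rw [← X0_mul_bas]; exact hX _ _

lemma bas_mul_step {a b : ℕ} (ha : a ≤ s) (hb : b + 2 ≤ s) :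
    bas k a 0 (s + 1 - a) * bas k 0 b (s - b) -
      bas k (a + 1) 0 (s + 1 - (a + 1)) * bas k 0 (b + 1) (s - (b + 1)) ∈ coordIdeal k s := by
  obtain ⟨N, rfl⟩ := Nat.exists_eq_add_of_le ha
  obtain ⟨M, hM⟩ : ∃ M, a + N = b + M + 2 := ⟨a + N - b - 2, by omega⟩
  have h1 : bas k a 0 (N + 2) ∈ coordIdeal k (a + N) :=
    bas_mem_coordIdeal (by unfold Std; omega)
  have h2 : bas k (a + 1) 0 (N + 1) ∈ coordIdeal k (a + N) :=
    bas_mem_coordIdeal (by unfold Std; omega)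
  have h3 := sub_mem (Ideal.mul_mem_right (bas k 0 b (M + 1)) _ h1)
    (Ideal.mul_mem_right (bas k 0 (b + 1) M) _ h2)
  rw [show a + N + 1 - a = N + 1 by omega, show a + N + 1 - (a + 1) = N by omega,
    show a + N - b = M + 2 by omega, show a + N - (b + 1) = M + 1 by omega]
  convert h3 using 1
  simp only [bas, E3, cont]
  ring

lemma bas_mul_steps {a b : ℕ} (d : ℕ) (ha : a + d ≤ s) (hb : b + d < s) :
    bas k a 0 (s + 1 - a) * bas k 0 b (s - b) -
      bas k (a + d) 0 (s + 1 - (a + d)) * bas k 0 (b + d) (s - (b + d)) ∈ coordIdeal k s := by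
  induction d with
  | zero => simp
  | succ d ih =>
    have := add_mem (ih (by omega) (by omega))
      (bas_mul_step (k := k) (s := s) (a := a + d) (b := b + d) (by omega) (by omega))
    rwa [sub_add_sub_cancel] at this

/-- The products defining the pairing between `T₁` and `T₂`. -/
lemma mk_bas_mul_bas (hs : 2 ≤ s) {a b : ℕ} (ha : a ≤ s) (hb : b < s) :
    Ideal.Quotient.mk (coordIdeal k s) (bas k a 0 (s + 1 - a) * bas k 0 b (s - b)) =
      if a = b + 1 then Ideal.Quotient.mk (coordIdeal k s) (socTop k s) else 0 := by
  have key : ∀ d, a + d ≤ s → b + d < s →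
      Ideal.Quotient.mk (coordIdeal k s) (bas k a 0 (s + 1 - a) * bas k 0 b (s - b)) =
      Ideal.Quotient.mk (coordIdeal k s)
        (bas k (a + d) 0 (s + 1 - (a + d)) * bas k 0 (b + d) (s - (b + d))) :=
    fun d h1 h2 => Ideal.Quotient.eq.2 (bas_mul_steps d h1 h2)
  have hmul : ∀ p q c, bas k p 0 c * bas k 0 q 1 = bas k p q c := by
    intro p q c; simp only [bas, E3, cont]; ring
  have hmul' : ∀ p q c, bas k p 0 1 * bas k 0 q c = bas k p q c := by
    intro p q c; simp only [bas, E3, cont]; ring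
  rcases Nat.lt_or_ge a (b + 1) with h | h
  · rw [if_neg (by omega), key (s - 1 - b) (by omega) (by omega),
      show s - (b + (s - 1 - b)) = 1 by omega, hmul, Ideal.Quotient.eq_zero_iff_mem]
    exact bas_mem fun d hd => by unfold Std; omega
  · rw [key (s - a) (by omega) (by omega), show s + 1 - (a + (s - a)) = 1 by omega, hmul',
      show a + (s - a) = s by omega]
    split_ifs with h1
    · rw [show b + (s - a) = s - 1 by omega, show s - (s - 1) = 1 by omega]
    · rw [Ideal.Quotient.eq_zero_iff_mem]
      exact bas_mem fun d hd => by unfold Std; omega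

lemma cyc2_mem_ker (hs : 2 ≤ s) (i : ℕ) :
    (fun l => Ideal.Quotient.mk (coordIdeal k s) (cyc2 k s i l)) ∈
      LinearMap.ker (kosd2 (coordIdeal k s)) := by
  rw [LinearMap.mem_ker]
  ext1 l
  rw [kosd2_mk, Pi.zero_apply, Ideal.Quotient.eq_zero_iff_mem]
  have hD := fun i => X_mul_mem_coordIdeal (k := k) hs i
  unfold cyc2
  split_ifs with h1 h2 h3 h4 h5
  · obtain ⟨c, hc⟩ : ∃ c, s = i + (c + 1) := ⟨s - i - 1, by omega⟩
    rw [show s - i = c + 1 by omega, show s - 1 - i = c by omega]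
    fin_cases l <;> simp [cross_apply, X0_mul_bas, X1_mul_bas, X2_mul_bas]
    · exact bas_mem (fun d hd => by unfold Std; omega)
    · exact bas_mem fun d hd => by unfold Std; omega
    · exact bas_mem fun d hd => by unfold Std; omega
  · obtain ⟨c, hc⟩ : ∃ c, 2 * s - 1 - i = c + 1 := ⟨2 * s - 2 - i, by omega⟩
    rw [hc, show 2 * s - 2 - i = c by omega]
    fin_cases l <;> simp [cross_apply, X0_mul_bas, X1_mul_bas, X2_mul_bas]
    · exact bas_mem fun d hd => by unfold Std; omega
    · exact bas_mem fun d hd => by unfold Std; omega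
    · exact bas_mem fun d hd => by unfold Std; omega
  · fin_cases l <;> simp [cross_apply, X0_mul_bas, X1_mul_bas]
    · exact bas_mem fun d hd => by unfold Std; omega
    · exact bas_mem fun d hd => by unfold Std; omega
  all_goals fin_cases l <;> simp [cross_apply, hD]

lemma socTop_mem_range (hs : 2 ≤ s) (c : MvP 3 k ⧸ coordIdeal k s) :
    (fun l => c * Ideal.Quotient.mk (coordIdeal k s) (![0, 0, socTop k s] l)) ∈
      LinearMap.range (kosd2 (coordIdeal k s)) := by
  obtain ⟨c, rfl⟩ := Ideal.Quotient.mk_surjective c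
  refine ⟨fun l => Ideal.Quotient.mk _ (![0, c * bas k (s - 1) (s - 1) 1, 0] l), ?_⟩
  ext1 l
  rw [kosd2_mk, ← map_mul, Ideal.Quotient.eq]
  have h0 := X2_mul_bas (k := k) (s - 1) (s - 1) 0
  rw [bas_zero, add_zero, zero_add] at h0
  have h1 := X0_mul_bas (k := k) (s - 1) (s - 1) 1
  rw [show s - 1 + 1 = s by omega] at h1
  fin_cases l
  · simp only [cross_apply]
    simp [mul_left_comm (X 2) c, h0]
    exact Ideal.mul_mem_left _ _ (bas_mem fun d hd => by unfold Std; omega)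
  · simp [cross_apply]
  · simp [cross_apply, mul_left_comm (X 0) c, h1]

end Products

section Pairing

variable {s : ℕ}

lemma bas_swap_mul_top_mem (hs : 2 ≤ s) {a b c : ℕ} (h : 0 < a ∨ 0 < b ∨ c ≠ 1) :
    bas k 0 0 (s + 1) * bas k a b c ∈ coordIdeal k s :=
  mul_comm (bas k a b c) _ ▸ bas_mul_top_mem hs h

lemma dotP_mk (I : Ideal (MvP 3 k)) (u v : Fin 3 → MvP 3 k) :
    dotP I (fun l => Ideal.Quotient.mk I (u l)) (fun l => Ideal.Quotient.mk I (v l)) =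
      Ideal.Quotient.mk I (∑ l, u l * v l) := by
  simp [dotP, map_sum, map_mul]

/-- The pairing between `T₁` and `T₂`. -/
lemma dotP_cyc (hs : 2 ≤ s) {i j : ℕ} (hi : i < 2 * s + 2) :
    dotP (coordIdeal k s) (fun l => Ideal.Quotient.mk _ (cyc1 k s i l))
      (fun l => Ideal.Quotient.mk _ (cyc2 k s j l)) =
      if i = j ∧ i < 2 * s - 1 then Ideal.Quotient.mk (coordIdeal k s) (socTop k s) else 0 := by
  rw [dotP_mk, Fin.sum_univ_three]
  by_cases h1 : i < s
  · simp only [cyc1, if_pos h1, Matrix.cons_val, zero_mul, zero_add, add_zero]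
    by_cases h2 : j < s
    · simp only [cyc2, if_pos h2, Matrix.cons_val]
      have h := mk_bas_mul_bas (k := k) hs (a := j + 1) (b := i) h2 h1
      rw [Nat.add_sub_add_right, mul_comm] at h
      rw [h]
      exact if_congr (by omega) rfl rfl
    · rw [if_neg (by omega), Ideal.Quotient.eq_zero_iff_mem]
      simp only [cyc2, if_neg h2]
      split_ifs
      · simp
      · simp
      · simp
      · exact bas_mul_top_mem hs (by omega)
      · simp
  by_cases h2 : i ≤ 2 * s
  · have hA : aIdx s i ≤ s := by unfold aIdx; split_ifs <;> omega
    simp only [cyc1, if_neg h1, if_pos h2, Matrix.cons_val, zero_mul, add_zero]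
    by_cases h3 : s ≤ j ∧ j < 2 * s - 1
    · simp only [cyc2, if_neg (not_lt.2 h3.1), if_pos h3.2, Matrix.cons_val]
      have h := mk_bas_mul_bas (k := k) hs (a := aIdx s i) (b := j - s + 1) hA (by omega)
      rw [show s - (j - s + 1) = 2 * s - 1 - j by omega] at h
      rw [h]
      exact if_congr (by unfold aIdx; split_ifs <;> omega) rfl rfl
    · rw [if_neg (by omega), Ideal.Quotient.eq_zero_iff_mem]
      simp only [cyc2]
      split_ifs
      · simp
      · omega
      · simp
      · exact bas_mul_top_mem hs (by omega)
      · simp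
      · simp
  · rw [if_neg (by omega), Ideal.Quotient.eq_zero_iff_mem]
    simp only [cyc1, if_neg h1, if_neg h2, Matrix.cons_val, zero_mul, zero_add, cyc2]
    split_ifs
    · exact bas_swap_mul_top_mem hs (by omega)
    · exact bas_swap_mul_top_mem hs (by omega)
    · exact bas_swap_mul_top_mem hs (by omega)
    · simp
    · simp
    · exact bas_swap_mul_top_mem hs (by omega)

lemma cyc1_cross_aux (hs : 2 ≤ s) {i j : ℕ} (hi : i < s) (hj : s ≤ j) :
    crossProduct (fun l => Ideal.Quotient.mk (coordIdeal k s) (cyc1 k s i l))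
      (fun l => Ideal.Quotient.mk (coordIdeal k s) (cyc1 k s j l)) ∈
      LinearMap.range (kosd2 (coordIdeal k s)) := by
  by_cases h : j ≤ 2 * s
  · have hA : aIdx s j ≤ s := by unfold aIdx; split_ifs <;> omega
    have hp := mk_bas_mul_bas (k := k) hs hA hi
    obtain ⟨c, hc⟩ : ∃ c, -Ideal.Quotient.mk (coordIdeal k s)
        (bas k (aIdx s j) 0 (s + 1 - aIdx s j) * bas k 0 i (s - i)) =
        c * Ideal.Quotient.mk (coordIdeal k s) (socTop k s) := by
      rw [hp]
      split_ifs
      · exact ⟨-1, by ring⟩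
      · exact ⟨0, by ring⟩
    convert socTop_mem_range hs c using 1
    ext1 l
    rw [mk_crossProduct]
    simp only [cyc1, if_pos hi, if_neg (not_lt.2 hj), if_pos h]
    fin_cases l
    · simp [cross_apply]
    · simp [cross_apply]
    · simp [cross_apply, ← hc, mul_comm]
  · convert zero_mem (LinearMap.range (kosd2 (coordIdeal k s))) using 1
    ext1 l
    rw [mk_crossProduct, Pi.zero_apply, Ideal.Quotient.eq_zero_iff_mem]
    simp only [cyc1, if_pos hi, if_neg (not_lt.2 hj), if_neg h]
    fin_cases l
    · simpa [cross_apply] using bas_mul_top_mem hs (by omega)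
    · simp [cross_apply]
    · simp [cross_apply]

/-- The product on `T₁` is zero. -/
lemma cyc1_cross (hs : 2 ≤ s) (i j : ℕ) :
    crossProduct (fun l => Ideal.Quotient.mk (coordIdeal k s) (cyc1 k s i l))
      (fun l => Ideal.Quotient.mk (coordIdeal k s) (cyc1 k s j l)) ∈
      LinearMap.range (kosd2 (coordIdeal k s)) := by
  by_cases h1 : i < s <;> by_cases h2 : j < s
  · convert zero_mem (LinearMap.range (kosd2 (coordIdeal k s))) using 1
    ext1 l
    rw [mk_crossProduct]
    simp only [cyc1, if_pos h1, if_pos h2]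
    fin_cases l <;> simp [cross_apply]
  · exact cyc1_cross_aux hs h1 (by omega)
  · rw [← cross_anticomm]
    exact neg_mem (cyc1_cross_aux hs h2 (by omega))
  · convert zero_mem (LinearMap.range (kosd2 (coordIdeal k s))) using 1
    ext1 l
    rw [mk_crossProduct, Pi.zero_apply, Ideal.Quotient.eq_zero_iff_mem]
    have hD : ∀ m, bas k (aIdx s m) 0 (s + 1 - aIdx s m) * bas k 0 0 (s + 1) ∈
        coordIdeal k s := fun m => bas_mul_top_mem hs (by omega)
    have hD' : ∀ m, bas k 0 0 (s + 1) * bas k (aIdx s m) 0 (s + 1 - aIdx s m) ∈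
        coordIdeal k s := fun m => bas_swap_mul_top_mem hs (by omega)
    simp only [cyc1, if_neg h1, if_neg h2]
    split_ifs <;> fin_cases l <;> simp [cross_apply, hD, hD']

end Pairing

section SecondTor

variable {s : ℕ}

lemma dotP_sum_smul (I : Ideal (MvP 3 k)) {ι : Type} [Fintype ι] (u : Fin 3 → MvP 3 k ⧸ I)
    (c : ι → k) (w : ι → Fin 3 → MvP 3 k ⧸ I) :
    dotP I u (∑ i, c i • w i) = ∑ i, c i • dotP I u (w i) := by
  simp only [dotP, Finset.sum_apply, Pi.smul_apply, Finset.mul_sum, Finset.smul_sum,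
    mul_smul_comm]
  exact Finset.sum_comm

lemma dotP_kosd3 (I : Ideal (MvP 3 k)) (u : Fin 3 → MvP 3 k ⧸ I) (f : MvP 3 k ⧸ I) :
    dotP I u (kosd3 I f) = kosd1 I u * f := by
  simp only [dotP, kosd3, kosd1, LinearMap.coe_mk, AddHom.coe_mk, Finset.sum_mul]
  exact Finset.sum_congr rfl fun i _ => by ring

lemma coords_cyc2 (hs : 2 ≤ s) (j : ℕ) (hj : j < 2 * s + 3) :
    coords k (cyc2 k s j 0) (0, 0, s) = (if j = 2 * s then 1 else 0) ∧
    coords k (cyc2 k s j 1) (0, 0, s) = (if j = 2 * s + 1 then 1 else 0) ∧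
    coords k (cyc2 k s j 2) (0, 0, s) = (if j = 2 * s + 2 then 1 else 0) ∧
    coords k (cyc2 k s j 2) (1, 0, s - 1) = (if j = 2 * s - 1 then 1 else 0) ∧
    coords k (cyc2 k s j 0) (1, 0, s - 1) = 0 ∧ coords k (cyc2 k s j 0) (2, 0, s - 2) = 0 := by
  simp only [cyc2]
  refine ⟨?_, ?_, ?_, ?_, ?_, ?_⟩ <;> split_ifs <;> first
    | omega
    | simp [coords_bas_apply]; done
    | (simp [coords_bas_apply]; omega)

lemma cyc2_independent (hs : 2 ≤ s) (c : Fin (2 * s + 3) → k)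
    (h : (∑ i, c i • fun l => Ideal.Quotient.mk (coordIdeal k s) (cyc2 k s i l)) ∈
      LinearMap.range (kosd3 (coordIdeal k s))) : c = 0 := by
  obtain ⟨f, hf⟩ := h
  have hlow : ∀ i : Fin (2 * s + 3), (i : ℕ) < 2 * s - 1 → c i = 0 := by
    intro i hi
    have hd := congrArg (dotP (coordIdeal k s)
      fun l => Ideal.Quotient.mk (coordIdeal k s) (cyc1 k s i l)) hf
    rw [dotP_kosd3, LinearMap.mem_ker.1 (cyc1_mem_ker hs ⟨i, by omega⟩), zero_mul, dotP_sum_smul,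
      Finset.sum_eq_single i] at hd
    · rw [dotP_cyc hs (by omega), if_pos ⟨rfl, hi⟩] at hd
      exact (smul_eq_zero.1 hd.symm).resolve_right
        ((socBasis_linearIndependent (k := k) hs).ne_zero 0)
    · intro j _ hj
      rw [dotP_cyc hs (by omega), if_neg (fun h => hj (Fin.ext h.1.symm)), smul_zero]
    · simp
  obtain ⟨f, rfl⟩ := Ideal.Quotient.mk_surjective f
  rw [sum_smul_mk] at hf
  have hco : ∀ (l : Fin 3) (p q r : ℕ), Std s p q r → coords k (X l * f) (p, q, r) =
      ∑ j, c j * coords k (cyc2 k s j l) (p, q, r) := by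
    intro l p q r hstd
    have h1 : X l * f - ∑ i, c i • cyc2 k s i l ∈ coordIdeal k s :=
      Ideal.Quotient.eq.1 (congrFun hf l)
    have h2 := h1 p q r hstd
    rw [map_sub, Pi.sub_apply, sub_eq_zero] at h2
    rw [h2, map_sum, Finset.sum_apply]
    simp
  have hsingle : ∀ m (hm : m < 2 * s + 3),
      ∑ j : Fin (2 * s + 3), c j * (if (j : ℕ) = m then 1 else 0) = c ⟨m, hm⟩ := by
    intro m hm
    rw [Finset.sum_eq_single ⟨m, hm⟩]
    · simp
    · intro j _ hj
      rw [if_neg (fun h => hj (Fin.ext h)), mul_zero]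
    · simp
  have hw := fun j : Fin (2 * s + 3) => coords_cyc2 (k := k) hs j j.2
  have e0 := hco 0 0 0 s (by unfold Std; omega)
  have e1 := hco 1 0 0 s (by unfold Std; omega)
  have e2 := hco 2 0 0 s (by unfold Std; omega)
  have e3 := hco 2 1 0 (s - 1) (by unfold Std; omega)
  have e4 := hco 0 1 0 (s - 1) (by unfold Std; omega)
  have e5 := hco 0 2 0 (s - 2) (by unfold Std; omega)
  rw [Finset.sum_congr rfl fun j _ => by rw [(hw j).1], hsingle _ (by omega), coords_X0_zero] at e0
  rw [Finset.sum_congr rfl fun j _ => by rw [(hw j).2.1], hsingle _ (by omega),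
    coords_X1_zero] at e1
  rw [Finset.sum_congr rfl fun j _ => by rw [(hw j).2.2.1], hsingle _ (by omega), coords_X2,
    if_neg (by omega), if_pos (Or.inl rfl), add_zero] at e2
  rw [Finset.sum_congr rfl fun j _ => by rw [(hw j).2.2.2.1], hsingle _ (by omega), coords_X2,
    if_neg (by omega), if_pos (Or.inr rfl), add_zero] at e3
  rw [Finset.sum_congr rfl fun j _ => by rw [(hw j).2.2.2.2.1, mul_zero], Finset.sum_const_zero,
    coords_X0_succ] at e4
  rw [Finset.sum_congr rfl fun j _ => by rw [(hw j).2.2.2.2.2, mul_zero], Finset.sum_const_zero,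
    coords_X0_succ] at e5
  rw [e4] at e2
  rw [Nat.sub_sub, e5] at e3
  ext ⟨i, hi⟩
  by_cases h1 : i < 2 * s - 1
  · exact hlow _ h1
  obtain rfl | rfl | rfl | rfl : i = 2 * s - 1 ∨ i = 2 * s ∨ i = 2 * s + 1 ∨ i = 2 * s + 2 := by
    omega
  · exact e3.symm
  · exact e0.symm
  · exact e1.symm
  · exact e2.symm

end SecondTor

section EulerCharacteristic

lemma finrank_span_sup {V : Type} [AddCommGroup V] [Module k V] [FiniteDimensional k V] {m : ℕ}
    {v : Fin m → V} {W : Submodule k V} (h : ∀ c : Fin m → k, ∑ i, c i • v i ∈ W → c = 0) :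
    finrank k (Submodule.span k (Set.range v) ⊔ W : Submodule k V) = m + finrank k W := by
  have hli : LinearIndependent k v := Fintype.linearIndependent_iff.2 fun c hc i =>
    congrFun (h c (hc ▸ W.zero_mem)) i
  have hdisj : Submodule.span k (Set.range v) ⊓ W = ⊥ := by
    rw [eq_bot_iff]
    rintro x ⟨hx, hW⟩
    obtain ⟨c, rfl⟩ := (Submodule.mem_span_range_iff_exists_fun k).1 hx
    simp [h c hW]
  have := Submodule.finrank_sup_add_finrank_inf_eq (Submodule.span k (Set.range v)) W
  rw [hdisj, finrank_bot, add_zero, finrank_span_eq_card hli, Fintype.card_fin] at this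
  exact this

lemma range_kosd2_le (I : Ideal (MvP 3 k)) :
    LinearMap.range (kosd2 I) ≤ LinearMap.ker (kosd1 I) := by
  rintro _ ⟨u, rfl⟩
  obtain ⟨u, rfl⟩ := exists_lift I u
  rw [LinearMap.mem_ker, show kosd2 I (fun l => Ideal.Quotient.mk I (u l)) =
    fun l => Ideal.Quotient.mk I (crossProduct (fun l => (X l : MvP 3 k)) u l) from
      funext (kosd2_mk I u), kosd1_mk, X_dot_crossProduct, map_zero]

lemma range_kosd3_le (I : Ideal (MvP 3 k)) :
    LinearMap.range (kosd3 I) ≤ LinearMap.ker (kosd2 I) := by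
  rintro _ ⟨f, rfl⟩
  obtain ⟨f, rfl⟩ := Ideal.Quotient.mk_surjective f
  rw [LinearMap.mem_ker, show kosd3 I (Ideal.Quotient.mk I f) =
    fun l => Ideal.Quotient.mk I (X l * f) from rfl]
  ext l
  rw [kosd2_mk]
  fin_cases l <;> simp [cross_apply] <;> ring_nf

variable {s : ℕ}

lemma finiteDimensional_quotient : FiniteDimensional k (MvP 3 k ⧸ coordIdeal k s) := by
  set b : Fin (s + 1) × Fin (s + 1) × Fin (s + 1) → MvP 3 k ⧸ coordIdeal k s :=
    fun t => Ideal.Quotient.mk _ (bas k t.1 t.2.1 (t.2.2 + 1))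
  refine ⟨⟨Set.Finite.toFinset (Set.finite_range b), ?_⟩⟩
  rw [Set.Finite.coe_toFinset, eq_top_iff]
  intro f _
  obtain ⟨f, rfl⟩ := Ideal.Quotient.mk_surjective f
  refine mem_of_coords ((Submodule.span k (Set.range b)).comap
    (Ideal.Quotient.mkₐ k (coordIdeal k s)).toLinearMap) f fun p q r _ => ?_
  change Ideal.Quotient.mk (coordIdeal k s) (bas k p q (r + 1)) ∈ Submodule.span k (Set.range b)
  by_cases h : Std s p q r
  · unfold Std at h
    exact Submodule.subset_span ⟨(⟨p, by omega⟩, ⟨q, by omega⟩, ⟨r, by omega⟩), rfl⟩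
  · rw [Ideal.Quotient.eq_zero_iff_mem.2 (bas_mem_coordIdeal h)]
    exact zero_mem _

lemma coords_X_mul_zero (l : Fin 3) (f : MvP 3 k) : coords k (X l * f) (0, 0, 0) = 0 := by
  fin_cases l
  · exact coords_X0_zero _ _ _
  · exact coords_X1_zero _ _ _
  · exact (coords_X2 _ _ _ _).trans (by simp)

lemma finrank_range_kosd1 (hs : 2 ≤ s) :
    1 + finrank k (LinearMap.range (kosd1 (coordIdeal k s))) =
      finrank k (MvP 3 k ⧸ coordIdeal k s) := by
  have := finiteDimensional_quotient (k := k) (s := s)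
  rw [← finrank_span_sup (v := fun _ : Fin 1 => (1 : MvP 3 k ⧸ coordIdeal k s))]
  · rw [← finrank_top k (MvP 3 k ⧸ coordIdeal k s)]
    refine congrArg (fun W : Submodule k _ => finrank k W) (eq_top_iff.2 ?_)
    intro f _
    obtain ⟨f, rfl⟩ := Ideal.Quotient.mk_surjective f
    obtain ⟨c, p, rfl⟩ := exists_eq_C_add f
    rw [map_add]
    refine Submodule.add_mem_sup ?_ ⟨fun l => Ideal.Quotient.mk _ (p l), ?_⟩
    · rw [Submodule.mem_span_range_iff_exists_fun]
      exact ⟨fun _ => c, by rw [Fin.sum_univ_one, C_eq_smul_one]; rfl⟩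
    · rw [kosd1_mk]
  · rintro c ⟨u, hu⟩
    obtain ⟨u, rfl⟩ := exists_lift _ u
    rw [kosd1_mk, Fin.sum_univ_one, ← (Ideal.Quotient.mk (coordIdeal k s)).map_one] at hu
    have h := (Ideal.Quotient.eq (y := c 0 • (1 : MvP 3 k))).1 hu 0 0 0 (by unfold Std; omega)
    rw [show (1 : MvP 3 k) = bas k 0 0 1 by simp [bas, cont]] at h
    rw [map_sub, map_sum, map_smul, Pi.sub_apply, Finset.sum_apply, Pi.smul_apply,
      coords_bas_apply, Finset.sum_eq_zero fun l _ => coords_X_mul_zero l (u l)] at h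
    ext i
    fin_cases i
    simpa using h

lemma ker_kosd2_le (hs : 2 ≤ s) : LinearMap.ker (kosd2 (coordIdeal k s)) ≤
    Submodule.span k (Set.range fun i : Fin (2 * s + 3) => fun l =>
      Ideal.Quotient.mk (coordIdeal k s) (cyc2 k s i l)) ⊔
      LinearMap.range (kosd3 (coordIdeal k s)) := by
  have := finiteDimensional_quotient (k := k) (s := s)
  have hsup1 : Submodule.span k (Set.range fun i : Fin (2 * s + 2) => fun l =>
      Ideal.Quotient.mk (coordIdeal k s) (cyc1 k s i l)) ⊔ LinearMap.range (kosd2 (coordIdeal k s)) = LinearMap.ker (kosd1 (coordIdeal k s)) := by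
    refine le_antisymm (sup_le (Submodule.span_le.2 ?_) (range_kosd2_le (coordIdeal k s))) (ker_kosd1_le hs)
    rintro _ ⟨i, rfl⟩
    exact cyc1_mem_ker hs i
  have hle : Submodule.span k (Set.range fun i : Fin (2 * s + 3) => fun l =>
      Ideal.Quotient.mk (coordIdeal k s) (cyc2 k s i l)) ⊔ LinearMap.range (kosd3 (coordIdeal k s)) ≤ LinearMap.ker (kosd2 (coordIdeal k s)) := by
    refine sup_le (Submodule.span_le.2 ?_) (range_kosd3_le (coordIdeal k s))
    rintro _ ⟨i, rfl⟩
    exact cyc2_mem_ker hs i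
  refine (Submodule.eq_of_le_of_finrank_eq hle ?_).ge
  have d1 := finrank_span_sup (cyc1_independent (k := k) hs)
  have d2 := finrank_span_sup (cyc2_independent (k := k) hs)
  rw [hsup1] at d1
  have r1 := (kosd1 (coordIdeal k s)).finrank_range_add_finrank_ker
  have r2 := (kosd2 (coordIdeal k s)).finrank_range_add_finrank_ker
  have r3 := (kosd3 (coordIdeal k s)).finrank_range_add_finrank_ker
  have e1 := finrank_range_kosd1 (k := k) hs
  have e3 := finrank_ker_kosd3 (k := k) hs
  have hpi : finrank k (Fin 3 → MvP 3 k ⧸ coordIdeal k s) = 3 * finrank k (MvP 3 k ⧸ coordIdeal k s) := by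
    rw [Module.finrank_pi_fintype]; simp
  rw [hpi] at r1 r2
  rw [d2]
  omega

end EulerCharacteristic

section ClassG

theorem torClassG_coordIdeal {s : ℕ} (hs : 2 ≤ s) : TorClassG (coordIdeal k s) (2 * s - 1) :=
  ⟨2 * s + 2, 2, by norm_num, (mu_coordIdeal hs).symm, by rw [socle_eq_ker, finrank_ker_kosd3 hs],
    fun i l => Ideal.Quotient.mk _ (cyc1 k s i l), fun i l => Ideal.Quotient.mk _ (cyc2 k s i l),
    socBasis k s, cyc1_mem_ker hs, fun i => cyc2_mem_ker hs i, socBasis_mem_ker hs,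
    ker_kosd1_le hs, cyc1_independent hs, ker_kosd2_le hs, cyc2_independent hs,
    socBasis_linearIndependent hs, ker_kosd3_le hs, fun i j => cyc1_cross hs i j,
    fun i _ => dotP_cyc hs i.2⟩

end ClassG

/-- Let `s ≥ 2`, `R = k[x,y,z]`, and let `V_s^s` be the
`(2s+1)×(2s+1)` alternating matrix above.  Then the ideal
`I = (Pf_j(V_s^s) : j ≠ s+1) + R₊·Pf_{s+1}(V_s^s)` defines a ring `R/I` of Tor algebra
class `G(2s−1)`.  (The index `s+1` is 1-based in the paper, hence `⟨s, _⟩` here.) -/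
theorem statement_7 {k : Type} [Field k] (s : ℕ) (hs : 2 ≤ s)
    (I : Ideal (MvP 3 k))
    (hI : I = trimPf (Vmat k s) ⟨s, by omega⟩ (irrIdeal 3 k)) :
    TorClassG I (2 * s - 1) := by
  rw [hI, trimPf_eq_coordIdeal hs _]
  exact torClassG_coordIdeal hs

end
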